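/- Let k be a field, let φ : Alt_m → GL_n(k) be a faithful irreducible representation, and suppose either m ≥ 9, or the characteristic of k is different from 2 and m ≥ 7. Then n ≥ m − 2; moreover, if in addition the characteristic of k is 0 or does not divide m, then n ≥ m − 1. -/

import Mathlib

/-- A representation `φ : H → GL_n(k)` is irreducible: `k^n` is a nonzero module whose only
`H`-invariant submodules are `⊥` and `⊤` (i.e. `k^n` is a simple `k[H]`-module). -/
def IrreducibleRep {k : Type*} [Field k] {H : Type*} [Group H] {n : ℕ}
    (φ : H →* Matrix.GeneralLinearGroup (Fin n) k) : Prop :=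
  (⊥ : Submodule k (Fin n → k)) ≠ ⊤ ∧
    ∀ W : Submodule k (Fin n → k),
      (∀ g : H, ∀ v ∈ W, Matrix.mulVec ((φ g : Matrix (Fin n) (Fin n) k)) v ∈ W) →
      W = ⊥ ∨ W = ⊤

open Equiv Equiv.Perm Module Representation

section Elements

variable {α β ι : Type} [Fintype α] [DecidableEq α] [Fintype β] [DecidableEq β]
  [Fintype ι] [DecidableEq ι]

/-- The product of the transpositions `(a b)` and `(c d)` as an element of the alternating group;
it is `1` unless `a ≠ b` and `c ≠ d`. -/
def dswap (a b c d : α) : alternatingGroup α :=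
  if h : a = b ∨ c = d then 1 else
    ⟨swap a b * swap c d, by
      rw [not_or] at h
      simp [mem_alternatingGroup, sign_swap h.1, sign_swap h.2]⟩

/-- The 3-cycle `a ↦ c ↦ b ↦ a` as an element of the alternating group. -/
abbrev tricycle (a b c : α) : alternatingGroup α := dswap a b a c

theorem coe_dswap {a b c d : α} (h₁ : a ≠ b) (h₂ : c ≠ d) :
    (dswap a b c d : Perm α) = swap a b * swap c d := by
  simp [dswap, h₁, h₂]

/-- The homomorphism of alternating groups induced by an embedding. -/
noncomputable def altMap (p : ι ↪ α) : alternatingGroup ι →* alternatingGroup α :=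
  ((viaEmbeddingHom p).comp (alternatingGroup ι).subtype).codRestrict _ fun g => by
    classical
    have := mem_alternatingGroup.1 g.2
    simp only [MonoidHom.comp_apply, Subgroup.subtype_apply, viaEmbeddingHom_apply,
      mem_alternatingGroup, viaEmbedding]
    convert (sign_extendDomain (g : Perm ι) (Equiv.ofInjective p.1 p.2)).trans this

theorem coe_altMap (p : ι ↪ α) (g : alternatingGroup ι) :
    (altMap p g : Perm α) = (g : Perm ι).viaEmbedding p := rfl

omit [Fintype α] in
theorem viaEmbedding_swap (p : ι ↪ α) (a b : ι) :
    (swap a b).viaEmbedding p = swap (p a) (p b) := by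
  ext x
  by_cases hx : x ∈ Set.range p
  · obtain ⟨y, rfl⟩ := hx
    rw [viaEmbedding_apply]
    simp only [swap_apply_def, p.injective.eq_iff]
    split_ifs <;> rfl
  · rw [viaEmbedding_apply_of_notMem _ _ _ hx, swap_apply_of_ne_of_ne]
    · rintro rfl; exact hx ⟨_, rfl⟩
    · rintro rfl; exact hx ⟨_, rfl⟩

theorem altMap_dswap (p : ι ↪ α) (a b c d : ι) :
    altMap p (dswap a b c d) = dswap (p a) (p b) (p c) (p d) := by
  by_cases h : a = b ∨ c = d
  · simp [dswap, h]
  · rw [not_or] at h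
    apply Subtype.ext
    rw [coe_altMap, coe_dswap h.1 h.2,
      coe_dswap (p.injective.ne h.1) (p.injective.ne h.2), ← viaEmbedding_swap,
      ← viaEmbedding_swap, ← viaEmbeddingHom_apply, map_mul]
    rfl

theorem commute_altMap (p : ι ↪ α) (q : β ↪ α) (h : ∀ i j, p i ≠ q j)
    (g : alternatingGroup ι) (g' : alternatingGroup β) :
    Commute (altMap p g) (altMap q g') := by
  have : Disjoint (altMap p g : Perm α) (altMap q g' : Perm α) := by
    intro x
    by_cases hx : x ∈ Set.range p
    · right
      obtain ⟨y, rfl⟩ := hx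
      exact viaEmbedding_apply_of_notMem _ _ _ fun ⟨j, hj⟩ => h _ _ hj.symm
    · exact Or.inl (viaEmbedding_apply_of_notMem _ _ _ hx)
  exact Subtype.ext this.commute

theorem exists_alternating_map_eq {n : ℕ} (hn : n + 2 ≤ Fintype.card α) (x y : Fin n ↪ α) :
    ∃ g : alternatingGroup α, ∀ i, (g : Perm α) (x i) = y i := by
  have := alternatingGroup.isMultiplyPretransitive α
  have : MulAction.IsMultiplyPretransitive (alternatingGroup α) α n :=
    MulAction.isMultiplyPretransitive_of_le (n := Nat.card α - 2)
      (by rw [Nat.card_eq_fintype_card]; omega) (by simp)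
  obtain ⟨g, hg⟩ := MulAction.exists_smul_eq (alternatingGroup α) x y
  exact ⟨g, fun i => by rw [← hg]; rfl⟩

theorem conj_dswap (g : alternatingGroup α) (a b c d : α) :
    g * dswap a b c d * g⁻¹ =
      dswap ((g : Perm α) a) ((g : Perm α) b) ((g : Perm α) c) ((g : Perm α) d) := by
  by_cases h : a = b ∨ c = d
  · simp [dswap, h]
  · rw [not_or] at h
    apply Subtype.ext
    have hi := (g : Perm α).injective
    rw [coe_dswap (hi.ne h.1) (hi.ne h.2), Subgroup.coe_mul, Subgroup.coe_mul,
      coe_dswap h.1 h.2, swap_apply_apply, swap_apply_apply]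
    simp [mul_assoc]

end Elements

section StandardVector

variable {α : Type} [Fintype α] [DecidableEq α] {k V : Type*} [Field k] [AddCommGroup V]
  [Module k V]

/-- A vector behaving like `e_a - e_b` in the permutation module of the alternating group. -/
structure IsStandardVector (ρ : Representation k (alternatingGroup α) V) (a b c : α) (w : V) :
    Prop where
  ne_zero : w ≠ 0
  neg : ∀ x y, x ≠ y → x ≠ a → x ≠ b → y ≠ a → y ≠ b → ρ (dswap a b x y) w = -w
  cycle : w + ρ (tricycle a b c) w + ρ (tricycle a b c) (ρ (tricycle a b c) w) = 0

variable {ρ : Representation k (alternatingGroup α) V} {a b c : α} {w : V}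

theorem IsStandardVector.apply_of_coe_eq (h : IsStandardVector ρ a b c w) (hab : a ≠ b)
    (f : Perm {x // x ≠ a ∧ x ≠ b}) :
    (∀ g : alternatingGroup α, (g : Perm α) = ofSubtype f → ρ g w = w) ∧
      ∀ g : alternatingGroup α, (g : Perm α) = swap a b * ofSubtype f → ρ g w = -w := by
  induction f using swap_induction_on with
  | one =>
    refine ⟨fun g hg => ?_, fun g hg => ?_⟩
    · rw [map_one] at hg
      rw [show g = 1 from Subtype.ext hg, map_one]
      rfl
    · have := mem_alternatingGroup.1 g.2
      rw [hg, map_one, mul_one, sign_swap hab] at this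
      exact absurd this (by decide)
  | swap_mul f x y hxy ih =>
    have hxy' : (x : α) ≠ y := fun h => hxy (Subtype.ext h)
    have hd := h.neg x y hxy' x.2.1 x.2.2 y.2.1 y.2.2
    have hdc := coe_dswap hab hxy'
    have hcomm : swap a b * swap (x : α) y = swap (x : α) y * swap a b := by
      rw [mul_swap_eq_swap_mul, swap_apply_of_ne_of_ne x.2.1 x.2.2,
        swap_apply_of_ne_of_ne y.2.1 y.2.2]
    refine ⟨fun g hg => ?_, fun g hg => ?_⟩
    · rw [map_mul, ofSubtype_swap_eq] at hg
      have := ih.2 ((dswap a b x y)⁻¹ * g) (by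
        rw [Subgroup.coe_mul, Subgroup.coe_inv, hdc, hg, mul_inv_rev, swap_inv, swap_inv,
          ← hcomm, mul_assoc, ← mul_assoc (swap (x : α) y), swap_mul_self, one_mul])
      rw [show g = dswap a b x y * ((dswap a b x y)⁻¹ * g) by group, map_mul, Module.End.mul_apply,
        this, map_neg, hd, neg_neg]
    · rw [map_mul, ofSubtype_swap_eq] at hg
      have := ih.1 ((dswap a b x y)⁻¹ * g) (by
        rw [Subgroup.coe_mul, Subgroup.coe_inv, hdc, hg, ← mul_assoc (swap a b),
          inv_mul_cancel_left])
      rw [show g = dswap a b x y * ((dswap a b x y)⁻¹ * g) by group, map_mul, Module.End.mul_apply,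
        this, hd]

theorem IsStandardVector.apply_eq_self (h : IsStandardVector ρ a b c w) (hab : a ≠ b)
    (g : alternatingGroup α) (ha : (g : Perm α) a = a) (hb : (g : Perm α) b = b) :
    ρ g w = w := by
  have hp : ∀ x, (x ≠ a ∧ x ≠ b) ↔ ((g : Perm α) x ≠ a ∧ (g : Perm α) x ≠ b) := fun x => by
    rw [← (g : Perm α).injective.ne_iff (x := x) (y := a), ha,
      ← (g : Perm α).injective.ne_iff (x := x) (y := b), hb]
  refine (h.apply_of_coe_eq hab ((g : Perm α).subtypePerm fun x => (hp x).symm)).1 g ?_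
  rw [ofSubtype_subtypePerm]
  intro x hx
  constructor <;> rintro rfl <;> contradiction

theorem IsStandardVector.apply_eq_neg (h : IsStandardVector ρ a b c w) (hab : a ≠ b)
    (hcard : 4 ≤ Fintype.card α)
    (g : alternatingGroup α) (ha : (g : Perm α) a = b) (hb : (g : Perm α) b = a) :
    ρ g w = -w := by
  obtain ⟨x, hx⟩ : ∃ x, x ∉ ({a, b} : Finset α) := by
    by_contra! H
    have := Finset.card_le_card (fun x _ => H x : Finset.univ ⊆ ({a, b} : Finset α))
    have := Finset.card_le_two (a := a) (b := b)
    rw [Finset.card_univ] at *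
    omega
  obtain ⟨y, hy⟩ : ∃ y, y ∉ ({a, b, x} : Finset α) := by
    by_contra! H
    have := Finset.card_le_card (fun x _ => H x : Finset.univ ⊆ ({a, b, x} : Finset α))
    have := Finset.card_le_three (a := a) (b := b) (c := x)
    rw [Finset.card_univ] at *
    omega
  simp only [Finset.mem_insert, Finset.mem_singleton, not_or] at hx hy
  have hd := h.neg x y (Ne.symm hy.2.2) hx.1 hx.2 hy.1 hy.2.1
  have hdc := coe_dswap hab (Ne.symm hy.2.2)
  have := h.apply_eq_self hab (g * dswap a b x y)
    (by simp [hdc, swap_apply_of_ne_of_ne (Ne.symm hx.1) (Ne.symm hy.1), hb])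
    (by simp [hdc, swap_apply_of_ne_of_ne (Ne.symm hx.2) (Ne.symm hy.2.1), ha])
  rw [map_mul, Module.End.mul_apply, hd, map_neg] at this
  rw [← neg_neg (ρ g w), this]

open Classical in
/-- The translates of a standard vector, analogous to `e_i - e_j`. -/
noncomputable def standardTranslate (ρ : Representation k (alternatingGroup α) V) (a b : α)
    (w : V) (i j : α) : V :=
  if h : i ≠ j ∧ ∃ g : alternatingGroup α, (g : Perm α) a = i ∧ (g : Perm α) b = j then
    ρ h.2.choose w else 0

theorem standardTranslate_self (i : α) : standardTranslate ρ a b w i i = 0 := by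
  simp [standardTranslate]

theorem IsStandardVector.translate_apply (h : IsStandardVector ρ a b c w) (hab : a ≠ b)
    (g : alternatingGroup α) :
    standardTranslate ρ a b w ((g : Perm α) a) ((g : Perm α) b) = ρ g w := by
  have H : (g : Perm α) a ≠ (g : Perm α) b ∧
      ∃ g' : alternatingGroup α, (g' : Perm α) a = (g : Perm α) a ∧
        (g' : Perm α) b = (g : Perm α) b := ⟨(g : Perm α).injective.ne hab, g, rfl, rfl⟩
  rw [standardTranslate, dif_pos H]
  have h1 := H.2.choose_spec
  have := h.apply_eq_self hab (g⁻¹ * H.2.choose)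
    (by rw [Subgroup.coe_mul, mul_apply, h1.1]; simp)
    (by rw [Subgroup.coe_mul, mul_apply, h1.2]; simp)
  conv_rhs => rw [← this]
  rw [← Module.End.mul_apply, ← map_mul]
  congr 2
  group

theorem exists_alternating_two (hcard : 4 ≤ Fintype.card α) {a b i j : α} (hab : a ≠ b)
    (hij : i ≠ j) : ∃ g : alternatingGroup α, (g : Perm α) a = i ∧ (g : Perm α) b = j := by
  obtain ⟨g, hg⟩ := exists_alternating_map_eq (n := 2) hcard
    ⟨[a, b].get, (by simpa using hab : [a, b].Nodup).injective_get⟩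
    ⟨[i, j].get, (by simpa using hij : [i, j].Nodup).injective_get⟩
  exact ⟨g, hg 0, hg 1⟩

theorem exists_alternating_three (hcard : 5 ≤ Fintype.card α) {a b c i j l : α}
    (h : [a, b, c].Nodup) (h' : [i, j, l].Nodup) :
    ∃ g : alternatingGroup α, (g : Perm α) a = i ∧ (g : Perm α) b = j ∧ (g : Perm α) c = l := by
  obtain ⟨g, hg⟩ := exists_alternating_map_eq (n := 3) hcard
    ⟨[a, b, c].get, h.injective_get⟩ ⟨[i, j, l].get, h'.injective_get⟩
  exact ⟨g, hg 0, hg 1, hg 2⟩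

theorem IsStandardVector.apply_translate (h : IsStandardVector ρ a b c w) (hab : a ≠ b)
    (hcard : 4 ≤ Fintype.card α) (g : alternatingGroup α) (i j : α) :
    ρ g (standardTranslate ρ a b w i j) =
      standardTranslate ρ a b w ((g : Perm α) i) ((g : Perm α) j) := by
  by_cases hij : i = j
  · subst hij
    simp [standardTranslate_self]
  obtain ⟨g', rfl, rfl⟩ := exists_alternating_two hcard hab hij
  rw [h.translate_apply hab, ← Module.End.mul_apply, ← map_mul, ← h.translate_apply hab]
  rfl

theorem IsStandardVector.translate_symm (h : IsStandardVector ρ a b c w) (hab : a ≠ b)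
    (hcard : 4 ≤ Fintype.card α) (i j : α) :
    standardTranslate ρ a b w j i = -standardTranslate ρ a b w i j := by
  by_cases hij : i = j
  · subst hij
    simp [standardTranslate_self]
  obtain ⟨g', rfl, rfl⟩ := exists_alternating_two hcard hab hij
  obtain ⟨s, hs, hs'⟩ := exists_alternating_two hcard hab hab.symm
  have := h.apply_eq_neg hab hcard s hs hs'
  rw [← h.translate_apply hab] at this
  rw [hs, hs'] at this
  have h1 := h.translate_apply hab 1
  simp only [Subgroup.coe_one, Perm.one_apply, map_one, Module.End.one_apply] at h1
  rw [← h.apply_translate hab hcard, ← h.apply_translate hab hcard, this, h1, map_neg]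

theorem IsStandardVector.translate_ne_zero (h : IsStandardVector ρ a b c w) (hab : a ≠ b)
    (hcard : 4 ≤ Fintype.card α) {i j : α} (hij : i ≠ j) :
    standardTranslate ρ a b w i j ≠ 0 := by
  obtain ⟨g', rfl, rfl⟩ := exists_alternating_two hcard hab hij
  rw [h.translate_apply hab]
  intro h0
  apply h.ne_zero
  have := congrArg (ρ g'⁻¹) h0
  rwa [← Module.End.mul_apply, ← map_mul, inv_mul_cancel, map_zero, map_one] at this

theorem IsStandardVector.translate_add (h : IsStandardVector ρ a b c w)
    (habc : [a, b, c].Nodup) (hcard : 5 ≤ Fintype.card α) (i j l : α) :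
    standardTranslate ρ a b w i j + standardTranslate ρ a b w j l =
      standardTranslate ρ a b w i l := by
  have hab : a ≠ b := by rintro rfl; simp at habc
  have hac : a ≠ c := by rintro rfl; simp at habc
  have hbc : b ≠ c := by rintro rfl; simp at habc
  by_cases hij : i = j
  · subst hij; simp [standardTranslate_self]
  by_cases hjl : j = l
  · subst hjl; simp [standardTranslate_self]
  by_cases hil : i = l
  · subst hil
    rw [h.translate_symm hab (by omega) i j, standardTranslate_self, add_neg_cancel]
  obtain ⟨g, rfl, rfl, rfl⟩ := exists_alternating_three hcard habc
    (show [i, j, l].Nodup by simp [hij, hjl, hil])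
  simp only [← h.apply_translate hab (by omega)]
  rw [← map_add]
  congr 1
  have h1 := h.translate_apply hab 1
  simp only [Subgroup.coe_one, Perm.one_apply, map_one, Module.End.one_apply] at h1
  have hc := coe_dswap hab hac
  have ta : (tricycle a b c : Perm α) a = c := by
    simp [hc, swap_apply_of_ne_of_ne hac.symm hbc.symm]
  have tb : (tricycle a b c : Perm α) b = a := by
    simp [hc, swap_apply_of_ne_of_ne hab.symm hbc]
  have tc : (tricycle a b c : Perm α) c = b := by simp [hc]
  have h2 := h.apply_translate hab (by omega) (tricycle a b c) a b
  have h3 := h.apply_translate hab (by omega) (tricycle a b c) c a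
  rw [ta, tb, h1] at h2
  rw [tc, ta] at h3
  have := h.cycle
  rw [h2, h3] at this
  rw [h1, h.translate_symm hab (by omega) c a, eq_neg_iff_add_eq_zero, ← this]
  abel

/-- Among sum-zero relations of the vectors `e_j - e_o`, only constant ones hold. -/
theorem IsStandardVector.coeff_eq (h : IsStandardVector ρ a b c w)
    (habc : [a, b, c].Nodup) (hcard : 6 ≤ Fintype.card α) (f : α → k) (hf : ∑ j, f j = 0)
    (hs : ∑ j, f j • standardTranslate ρ a b w j a = 0) (i l : α) : f i = f l := by
  have hab : a ≠ b := by rintro rfl; simp at habc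
  set v := standardTranslate ρ a b w with hv
  by_contra hil
  have hil' : i ≠ l := fun H => hil (by rw [H])
  obtain ⟨j, hj⟩ : ∃ x, x ∉ ({i, l} : Finset α) := by
    by_contra! H
    have := Finset.card_le_card (fun x _ => H x : Finset.univ ⊆ ({i, l} : Finset α))
    have := Finset.card_le_two (a := i) (b := l)
    rw [Finset.card_univ] at *
    omega
  obtain ⟨q, hq⟩ : ∃ y, y ∉ ({i, l, j} : Finset α) := by
    by_contra! H
    have := Finset.card_le_card (fun x _ => H x : Finset.univ ⊆ ({i, l, j} : Finset α))
    have := Finset.card_le_three (a := i) (b := l) (c := j)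
    rw [Finset.card_univ] at *
    omega
  simp only [Finset.mem_insert, Finset.mem_singleton, not_or] at hj hq
  have hadd := h.translate_add habc (by omega)
  have hsymm := h.translate_symm hab (by omega)
  have hact := h.apply_translate hab (by omega)
  rw [← hv] at hadd hsymm hact
  -- the relation is invariant under change of base point and under the group
  have key : ∀ g : alternatingGroup α, ∑ j, f j • v ((g : Perm α) j) a = 0 := fun g => by
    have h1 := congrArg (ρ g) hs
    rw [map_sum, map_zero] at h1
    simp only [map_smul, hact] at h1
    calc ∑ x, f x • v ((g : Perm α) x) a
        = ∑ x, (f x • v ((g : Perm α) x) ((g : Perm α) a) + f x • v ((g : Perm α) a) a) :=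
          Finset.sum_congr rfl fun x _ => by rw [← smul_add, hadd]
      _ = 0 := by rw [Finset.sum_add_distrib, h1, ← Finset.sum_smul, hf, zero_smul, add_zero]
  have hcyc := coe_dswap (a := i) (b := l) (c := i) (d := j) hil' (Ne.symm hj.1)
  have ti : (tricycle i l j : Perm α) i = j := by
    simp [hcyc, swap_apply_of_ne_of_ne hj.1 hj.2]
  have tl : (tricycle i l j : Perm α) l = i := by
    simp [hcyc, swap_apply_of_ne_of_ne hil'.symm (Ne.symm hj.2)]
  have tj : (tricycle i l j : Perm α) j = l := by simp [hcyc]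
  have hdiff : ∑ x, f x • v ((tricycle i l j : Perm α) x) x = 0 := by
    have h3 : ∀ x, v ((tricycle i l j : Perm α) x) x =
        v ((tricycle i l j : Perm α) x) a - v x a := fun x => by
      rw [← hadd _ x a, add_sub_cancel_right]
    simp only [h3, smul_sub, Finset.sum_sub_distrib, key, hs, sub_zero]
  have hsub : ∑ x ∈ ({i, l, j} : Finset α), f x • v ((tricycle i l j : Perm α) x) x = 0 := by
    rw [← hdiff]
    refine Finset.sum_subset (Finset.subset_univ _) fun x _ hx => ?_
    simp only [Finset.mem_insert, Finset.mem_singleton, not_or] at hx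
    have : (tricycle i l j : Perm α) x = x := by
      simp [hcyc, swap_apply_of_ne_of_ne hx.1 hx.2.1, swap_apply_of_ne_of_ne hx.1 hx.2.2]
    rw [this, hv, standardTranslate_self, smul_zero]
  rw [Finset.sum_insert (by simp [hil', Ne.symm hj.1]),
    Finset.sum_insert (by simp [Ne.symm hj.2]), Finset.sum_singleton, ti, tl, tj] at hsub
  have hrel : (f i - f j) • v j i + (f l - f j) • v i l = 0 := by
    have : v l j = -(v j i + v i l) := by rw [hadd, hsymm]
    rw [this] at hsub
    rw [← hsub]
    module
  obtain ⟨g, g1, g2, g3⟩ := exists_alternating_three (a := j) (b := i) (c := l) (i := j) (j := i)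
    (l := q) (by omega) (by simp [hj.1, hj.2, hil']) (by
      simp [hj.1, Ne.symm hq.1, Ne.symm hq.2.2])
  have hrel' := congrArg (ρ g) hrel
  rw [map_add, map_smul, map_smul, map_zero, hact, hact, g1, g2, g3] at hrel'
  have h4 : (f l - f j) • v l q = 0 := by
    have : v l q = v i q - v i l := by rw [← hadd i l q, add_sub_cancel_left]
    rw [this, smul_sub, sub_eq_zero]
    rw [← add_left_cancel_iff (a := (f i - f j) • v j i), hrel, hrel']
  have h5 := (smul_eq_zero.1 h4).resolve_right
    (h.translate_ne_zero hab (by omega) (Ne.symm hq.2.1))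
  rw [h5, zero_smul, add_zero] at hrel
  have h6 := (smul_eq_zero.1 hrel).resolve_right
    (h.translate_ne_zero hab (by omega) hj.1)
  exact hil (by rw [sub_eq_zero.1 h5, sub_eq_zero.1 h6])

theorem IsStandardVector.le_finrank [FiniteDimensional k V] (h : IsStandardVector ρ a b c w)
    (habc : [a, b, c].Nodup) (hcard : 6 ≤ Fintype.card α) :
    Fintype.card α ≤ finrank k V + 2 ∧
      ((Fintype.card α : k) ≠ 0 → Fintype.card α ≤ finrank k V + 1) := by
  let T : (α → k) →ₗ[k] V × k :=
    { toFun f := (∑ j, f j • standardTranslate ρ a b w j a, ∑ j, f j)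
      map_add' f g := by simp [add_smul, Finset.sum_add_distrib]
      map_smul' r f := by simp [mul_smul, Finset.smul_sum, Finset.mul_sum] }
  have hT := T.finrank_range_add_finrank_ker
  have hr : finrank k T.range ≤ finrank k V + 1 := by
    simpa using T.range.finrank_le
  rw [finrank_fintype_fun_eq_card] at hT
  have hker : ∀ f ∈ T.ker, ∑ j, f j = 0 ∧ ∀ i l, f i = f l := fun f hf => by
    have h0 : T f = 0 := hf
    have h1 : ∑ j, f j = 0 := congrArg Prod.snd h0
    exact ⟨h1, h.coeff_eq habc hcard f h1 (congrArg Prod.fst h0)⟩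
  constructor
  · have : finrank k T.ker ≤ 1 := by
      refine (Submodule.finrank_mono (t := Submodule.span k {fun _ => (1 : k)})
        fun f hf => ?_).trans (finrank_span_singleton fun H => one_ne_zero (congrFun H a)).le
      rw [Submodule.mem_span_singleton]
      exact ⟨f a, funext fun x => by simpa using (hker f hf).2 a x⟩
    omega
  · intro hc
    have : T.ker = ⊥ := by
      rw [Submodule.eq_bot_iff]
      intro f hf
      obtain ⟨h1, h2⟩ := hker f hf
      have h3 : ∑ j, f j = (Fintype.card α : k) * f a := by
        rw [Finset.sum_congr rfl fun x _ => h2 x a]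
        simp
      rw [h3, mul_eq_zero] at h1
      exact funext fun x => (h2 x a).trans (h1.resolve_left hc)
    rw [this, finrank_bot] at hT
    omega

end StandardVector

section JointEigenspace

variable {G k V : Type*} [Group G] [Field k] [AddCommGroup V] [Module k V]

/-- The vectors on which each of the listed group elements acts by the listed scalar. -/
def jointEigenspace (ρ : Representation k G V) (L : List (G × k)) : Submodule k V where
  carrier := {v | ∀ e ∈ L, ρ e.1 v = e.2 • v}
  add_mem' hv hw e he := by rw [map_add, hv e he, hw e he, smul_add]
  zero_mem' e _ := by rw [map_zero, smul_zero]
  smul_mem' r v hv e he := by rw [map_smul, hv e he, smul_comm]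

variable {ρ : Representation k G V} {L : List (G × k)}

@[simp] theorem mem_jointEigenspace_nil {v : V} : v ∈ jointEigenspace ρ [] := by
  simp [jointEigenspace]

theorem jointEigenspace_nil : jointEigenspace ρ [] = ⊤ :=
  eq_top_iff.2 fun _ _ => mem_jointEigenspace_nil

@[simp] theorem mem_jointEigenspace_cons {v : V} {g : G} {r : k} :
    v ∈ jointEigenspace ρ ((g, r) :: L) ↔ ρ g v = r • v ∧ v ∈ jointEigenspace ρ L := by
  simp [jointEigenspace]

theorem apply_mem_jointEigenspace {h : G} (hL : ∀ e ∈ L, Commute h e.1) {v : V}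
    (hv : v ∈ jointEigenspace ρ L) : ρ h v ∈ jointEigenspace ρ L := fun e he => by
  rw [← Module.End.mul_apply, ← map_mul, ← (hL e he).eq, map_mul, Module.End.mul_apply, hv e he,
    map_smul]

theorem apply_inv_apply (g : G) (v : V) : ρ g⁻¹ (ρ g v) = v := by
  rw [← Module.End.mul_apply, ← map_mul, inv_mul_cancel, map_one, Module.End.one_apply]

theorem apply_apply_inv (g : G) (v : V) : ρ g (ρ g⁻¹ v) = v := by
  rw [← Module.End.mul_apply, ← map_mul, mul_inv_cancel, map_one, Module.End.one_apply]

theorem jointEigenspace_inv {g : G} {r : k} (hr : r ≠ 0) :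
    jointEigenspace ρ ((g⁻¹, r⁻¹) :: L) = jointEigenspace ρ ((g, r) :: L) := by
  ext v
  rw [mem_jointEigenspace_cons, mem_jointEigenspace_cons]
  refine and_congr_left fun _ => ⟨fun h => ?_, fun h => ?_⟩
  · have := congrArg (ρ g) h
    rw [apply_apply_inv, map_smul] at this
    exact ((inv_smul_eq_iff₀ hr).1 this.symm)
  · have := congrArg (ρ g⁻¹) h
    rw [apply_inv_apply, map_smul] at this
    exact ((eq_inv_smul_iff₀ hr).2 this.symm)

theorem finrank_jointEigenspace_conj (h : G) :
    finrank k (jointEigenspace ρ (L.map fun e => (h * e.1 * h⁻¹, e.2))) =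
      finrank k (jointEigenspace ρ L) := by
  have : jointEigenspace ρ (L.map fun e => (h * e.1 * h⁻¹, e.2)) =
      (jointEigenspace ρ L).map (LinearEquiv.ofLinearMap (ρ h) (ρ h⁻¹)
        (LinearMap.ext fun v => apply_apply_inv h v)
        (LinearMap.ext fun v => apply_inv_apply h v)).toLinearMap := by
    ext v
    rw [Submodule.mem_map_equiv]
    refine ⟨fun hv e he => ?_, fun hv e' he' => ?_⟩
    · have := hv _ (List.mem_map.2 ⟨e, he, rfl⟩)
      simp only [map_mul, Module.End.mul_apply] at this
      have := congrArg (ρ h⁻¹) this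
      rwa [apply_inv_apply, map_smul] at this
    · obtain ⟨e, he, rfl⟩ := List.mem_map.1 he'
      have := congrArg (ρ h) (hv e he)
      simp only [map_mul, Module.End.mul_apply]
      rw [map_smul] at this
      exact this.trans (congrArg _ (apply_apply_inv h v))
  rw [this, LinearEquiv.finrank_map_eq]

theorem finrank_eq_add_of_involution [FiniteDimensional k V] (h2 : (2 : k) ≠ 0) {c : G}
    (hc : c * c = 1) (hL : ∀ e ∈ L, Commute c e.1) :
    finrank k (jointEigenspace ρ L) = finrank k (jointEigenspace ρ ((c, 1) :: L)) +
      finrank k (jointEigenspace ρ ((c, -1) :: L)) := by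
  have hcc : ∀ v, ρ c (ρ c v) = v := fun v => by
    rw [← Module.End.mul_apply, ← map_mul, hc, map_one, Module.End.one_apply]
  rw [← Submodule.finrank_sup_add_finrank_inf_eq]
  have h1 : jointEigenspace ρ ((c, 1) :: L) ⊔ jointEigenspace ρ ((c, -1) :: L) =
      jointEigenspace ρ L := by
    refine le_antisymm (sup_le ?_ ?_) fun v hv => ?_
    · exact fun v hv => (mem_jointEigenspace_cons.1 hv).2
    · exact fun v hv => (mem_jointEigenspace_cons.1 hv).2
    · have hcv := apply_mem_jointEigenspace hL hv
      have : v = (2 : k)⁻¹ • (v + ρ c v) + (2 : k)⁻¹ • (v - ρ c v) := by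
        match_scalars <;> field_simp <;> ring
      rw [this]
      refine Submodule.add_mem_sup (Submodule.smul_mem _ _ ?_) (Submodule.smul_mem _ _ ?_)
      · rw [mem_jointEigenspace_cons, map_add, hcc]
        exact ⟨by module, add_mem hv hcv⟩
      · rw [mem_jointEigenspace_cons, map_sub, hcc]
        exact ⟨by module, sub_mem hv hcv⟩
  have h0 : jointEigenspace ρ ((c, 1) :: L) ⊓ jointEigenspace ρ ((c, -1) :: L) = ⊥ := by
    rw [Submodule.eq_bot_iff]
    rintro v ⟨hv1, hv2⟩
    have e1 := (mem_jointEigenspace_cons.1 hv1).1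
    have e2 := (mem_jointEigenspace_cons.1 hv2).1
    rw [e1] at e2
    have : (2 : k) • v = 0 := by linear_combination (norm := module) e2
    exact (smul_eq_zero.1 this).resolve_left h2
  rw [h1, h0, finrank_bot, add_zero]

/-- The component in the `ω`-eigenspace of an operator of order three. -/
def cubicPart (ρ : Representation k G V) (c : G) (w : k) : V →ₗ[k] V :=
  LinearMap.id + w ^ 2 • ρ c + w • (ρ c ∘ₗ ρ c)

theorem cubicPart_apply (c : G) (w : k) (v : V) :
    cubicPart ρ c w v = v + w ^ 2 • ρ c v + w • ρ c (ρ c v) := rfl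

theorem apply_cubicPart {c : G} (hc : c ^ 3 = 1) {w : k} (hw : w ^ 3 = 1) (v : V) :
    ρ c (cubicPart ρ c w v) = w • cubicPart ρ c w v := by
  have hcc : ρ c (ρ c (ρ c v)) = v := by
    simp only [← Module.End.mul_apply, ← map_mul]
    rw [← pow_three, hc, map_one, Module.End.one_apply]
  simp only [cubicPart_apply, map_add, map_smul, hcc]
  match_scalars
  · linear_combination -hw
  · ring
  · ring

theorem cubicPart_mem {c : G} (hc : c ^ 3 = 1) {w : k} (hw : w ^ 3 = 1)
    (hL : ∀ e ∈ L, Commute c e.1) {v : V} (hv : v ∈ jointEigenspace ρ L) :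
    cubicPart ρ c w v ∈ jointEigenspace ρ ((c, w) :: L) := by
  rw [mem_jointEigenspace_cons]
  refine ⟨apply_cubicPart hc hw v, ?_⟩
  have hcv := apply_mem_jointEigenspace hL hv
  rw [cubicPart_apply]
  exact add_mem (add_mem hv (Submodule.smul_mem _ _ hcv))
    (Submodule.smul_mem _ _ (apply_mem_jointEigenspace hL hcv))

theorem eq_sum_cubicPart [CharP k 2] {w : k} (hw : w ^ 2 + w + 1 = 0) (c : G) (v : V) :
    v = cubicPart ρ c 1 v + cubicPart ρ c w v + cubicPart ρ c (w ^ 2) v := by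
  have h2 : (2 : k) = 0 := CharTwo.two_eq_zero
  simp only [cubicPart_apply]
  match_scalars
  · linear_combination -h2
  · linear_combination -(w ^ 2 - w + 1) * hw
  · linear_combination -hw

theorem finrank_eq_add_of_cubic [FiniteDimensional k V] [CharP k 2] {w : k}
    (hw : w ^ 2 + w + 1 = 0) {c : G} (hc : c ^ 3 = 1) (hL : ∀ e ∈ L, Commute c e.1) :
    finrank k (jointEigenspace ρ L) = finrank k (jointEigenspace ρ ((c, 1) :: L)) +
      finrank k (jointEigenspace ρ ((c, w) :: L)) +
      finrank k (jointEigenspace ρ ((c, w ^ 2) :: L)) := by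
  have h2 : (2 : k) = 0 := CharTwo.two_eq_zero
  have hw3 : w ^ 3 = 1 := by linear_combination (w - 1) * hw
  have hw0 : w ≠ 0 := by rintro rfl; simp at hw
  have hw1 : w + 1 ≠ 0 := fun h => by
    have : w ^ 2 = 0 := by linear_combination hw - h
    exact hw0 (pow_eq_zero_iff (two_ne_zero)|>.1 this)
  set A := jointEigenspace ρ ((c, 1) :: L)
  set B := jointEigenspace ρ ((c, w) :: L)
  set C := jointEigenspace ρ ((c, w ^ 2) :: L)
  have hAB : A ⊓ B = ⊥ := by
    rw [Submodule.eq_bot_iff]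
    rintro v ⟨hv1, hv2⟩
    have e1 := (mem_jointEigenspace_cons.1 hv1).1
    have e2 := (mem_jointEigenspace_cons.1 hv2).1
    rw [e1] at e2
    have : (w + 1) • v = 0 := by
      rw [one_smul] at e2
      rw [add_smul, ← e2, one_smul, ← two_smul k, h2, zero_smul]
    exact (smul_eq_zero.1 this).resolve_left hw1
  have hABC : (A ⊔ B) ⊓ C = ⊥ := by
    rw [Submodule.eq_bot_iff]
    rintro v ⟨hv1, hv2⟩
    obtain ⟨a, ha, b, hb, rfl⟩ := Submodule.mem_sup.1 hv1
    have ea := (mem_jointEigenspace_cons.1 ha).1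
    have eb := (mem_jointEigenspace_cons.1 hb).1
    have e := (mem_jointEigenspace_cons.1 hv2).1
    have e' := congrArg (ρ c) e
    simp only [map_add, map_smul, ea, eb] at e e'
    have c1 : 1 - w ^ 2 = w := by linear_combination h2 - hw
    have c2 : w - w ^ 2 = 1 := by linear_combination w * h2 - hw
    have h1 : (1 - w ^ 2) • a + (w - w ^ 2) • b = 0 := by
      linear_combination (norm := module) e
    have h3 : (1 - w ^ 2) • a - (1 - w ^ 2) • b = 0 := by
      linear_combination (norm := module) e' + hw3 • b
    rw [c1, c2, one_smul] at h1
    rw [c1, ← smul_sub] at h3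
    have hab := sub_eq_zero.1 ((smul_eq_zero.1 h3).resolve_left hw0)
    rw [← hab] at h1
    have ha0 := (smul_eq_zero.1 ((add_smul w 1 a).trans (by rw [one_smul, h1]))).resolve_left hw1
    rw [← hab, ha0, add_zero]
  have hsup : A ⊔ B ⊔ C = jointEigenspace ρ L := by
    refine le_antisymm (sup_le (sup_le ?_ ?_) ?_) fun v hv => ?_
    · exact fun v hv => (mem_jointEigenspace_cons.1 hv).2
    · exact fun v hv => (mem_jointEigenspace_cons.1 hv).2
    · exact fun v hv => (mem_jointEigenspace_cons.1 hv).2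
    · rw [eq_sum_cubicPart (ρ := ρ) hw c v]
      exact Submodule.add_mem_sup (Submodule.add_mem_sup
        (cubicPart_mem hc (one_pow 3) hL hv) (cubicPart_mem hc hw3 hL hv))
        (cubicPart_mem hc (by rw [← pow_mul, mul_comm, pow_mul, hw3, one_pow]) hL hv)
  have h1 := Submodule.finrank_sup_add_finrank_inf_eq A B
  have h3 := Submodule.finrank_sup_add_finrank_inf_eq (A ⊔ B) C
  rw [hAB, finrank_bot] at h1
  rw [hABC, hsup, finrank_bot] at h3
  omega

/-- An operator preserving a line acts on it by a scalar. -/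
theorem exists_smul_of_finrank_eq_one {W : Submodule k V} (hW : finrank k W = 1) (f : V →ₗ[k] V)
    (hf : ∀ v ∈ W, f v ∈ W) : ∃ r : k, ∀ v ∈ W, f v = r • v := by
  obtain ⟨e, he, h⟩ := finrank_eq_one_iff'.1 hW
  obtain ⟨r, hr⟩ := h ⟨f e, hf e e.2⟩
  refine ⟨r, fun v hv => ?_⟩
  obtain ⟨s, hs⟩ := h ⟨v, hv⟩
  have hs' : s • (e : V) = v := congrArg Subtype.val hs
  have hr' : r • (e : V) = f e := congrArg Subtype.val hr
  rw [← hs', map_smul, ← hr', smul_comm]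

theorem exists_ne_zero_of_finrank_eq_one {W : Submodule k V} (hW : finrank k W = 1) :
    ∃ v ∈ W, v ≠ 0 := by
  obtain ⟨e, he, -⟩ := finrank_eq_one_iff'.1 hW
  exact ⟨e, e.2, fun h => he (Subtype.ext h)⟩

end JointEigenspace

section Restriction

variable {α β ι : Type} [Fintype α] [DecidableEq α] [Fintype β] [DecidableEq β]
  [Fintype ι] [DecidableEq ι]

theorem dswap_apply_of_ne {a b c d x : α} (ha : x ≠ a) (hb : x ≠ b) (hc : x ≠ c) (hd : x ≠ d) :
    (dswap a b c d : Perm α) x = x := by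
  by_cases h : a = b ∨ c = d
  · simp [dswap, h]
  · rw [not_or] at h
    simp [coe_dswap h.1 h.2, swap_apply_of_ne_of_ne, ha, hb, hc, hd]

theorem commute_dswap {g : alternatingGroup α} {a b c d : α} (ha : (g : Perm α) a = a)
    (hb : (g : Perm α) b = b) (hc : (g : Perm α) c = c) (hd : (g : Perm α) d = d) :
    Commute g (dswap a b c d) := by
  have := conj_dswap g a b c d
  rw [ha, hb, hc, hd] at this
  exact mul_inv_eq_iff_eq_mul.1 this

theorem tricycle_eq_mul {a b c d : α} (hab : a ≠ b) (hac : a ≠ c) (hcd : c ≠ d) :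
    dswap a b c d = tricycle a b c * dswap a c c d := by
  apply Subtype.ext
  rw [Subgroup.coe_mul, coe_dswap hab hcd, coe_dswap hab hac, coe_dswap hac hcd]
  rw [mul_assoc, swap_mul_self_mul]

theorem altMap_apply_of_notMem (p : ι ↪ α) (g : alternatingGroup ι) {x : α}
    (hx : x ∉ Set.range p) : (altMap p g : Perm α) x = x :=
  viaEmbedding_apply_of_notMem _ _ _ hx

variable {k V : Type*} [Field k] [AddCommGroup V] [Module k V]

/-- No product of two disjoint transpositions acts trivially. -/
def MovesAll (ρ : Representation k (alternatingGroup α) V) : Prop :=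
  ∀ a b c d, [a, b, c, d].Nodup → ρ (dswap a b c d) ≠ 1

variable {ρ : Representation k (alternatingGroup α) V}

theorem map_conj_eq_one {G : Type*} [Group G] {ρ : Representation k G V} (g x : G)
    (h : ρ (g * x * g⁻¹) = 1) : ρ x = 1 := by
  rw [show x = g⁻¹ * (g * x * g⁻¹) * g by group, map_mul, map_mul, h, mul_one, ← map_mul,
    inv_mul_cancel, map_one]

theorem movesAll_of_ne (hcard : 6 ≤ Fintype.card α) {a b c d : α} (h : [a, b, c, d].Nodup)
    (hne : ρ (dswap a b c d) ≠ 1) : MovesAll ρ := by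
  intro x y z t hx h1
  obtain ⟨g, hg⟩ := exists_alternating_map_eq (n := 4) hcard
    ⟨[a, b, c, d].get, h.injective_get⟩ ⟨[x, y, z, t].get, hx.injective_get⟩
  refine hne (map_conj_eq_one g _ ?_)
  rw [conj_dswap]
  rw [← h1]
  exact congrArg ρ (by congr 1; exacts [hg 0, hg 1, hg 2, hg 3])

theorem MovesAll.tricycle_ne_one (h : MovesAll ρ) (hcard : 5 ≤ Fintype.card α) {a b c : α}
    (habc : [a, b, c].Nodup) : ρ (tricycle a b c) ≠ 1 := by
  intro h1
  have key : ∀ i j l, [i, j, l].Nodup → ρ (tricycle i j l) = 1 := fun i j l hl => by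
    obtain ⟨g, rfl, rfl, rfl⟩ := exists_alternating_three hcard habc hl
    rw [← h1, tricycle, ← conj_dswap, map_mul, map_mul, h1, mul_one, ← map_mul, mul_inv_cancel,
      map_one]
  obtain ⟨d, hd⟩ : ∃ y, y ∉ ({a, b, c} : Finset α) := by
    by_contra! H
    have := Finset.card_le_card (fun x _ => H x : Finset.univ ⊆ ({a, b, c} : Finset α))
    have := Finset.card_le_three (a := a) (b := b) (c := c)
    rw [Finset.card_univ] at *
    omega
  simp only [Finset.mem_insert, Finset.mem_singleton, not_or, List.nodup_cons, List.mem_cons,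
    List.not_mem_nil, or_false, not_false_eq_true, List.nodup_nil, and_true] at hd habc
  apply h a b c d (by simp [habc, Ne.symm hd.1, Ne.symm hd.2.1, Ne.symm hd.2.2])
  rw [tricycle_eq_mul habc.1.1 habc.1.2 (Ne.symm hd.2.2), map_mul, h1, one_mul,
    show dswap a c c d = tricycle c a d by
      apply Subtype.ext
      rw [coe_dswap habc.1.2 (Ne.symm hd.2.2), coe_dswap (Ne.symm habc.1.2) (Ne.symm hd.2.2),
        swap_comm a c]]
  exact key _ _ _ (by simp [Ne.symm habc.1.2, Ne.symm hd.1, Ne.symm hd.2.2])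

/-- The representation on a subspace that is stable under an embedded alternating group. -/
noncomputable def altRestrict (ρ : Representation k (alternatingGroup α) V) (p : ι ↪ α)
    (W : Submodule k V)
    (hW : ∀ g, ∀ v ∈ W, ρ (altMap p g) v ∈ W) : Representation k (alternatingGroup ι) W :=
  Subrepresentation.toRepresentation (ρ := ρ.comp (altMap p)) ⟨W, fun g v hv => hW g v hv⟩

theorem altRestrict_apply_coe (p : ι ↪ α) (W : Submodule k V)
    (hW : ∀ g, ∀ v ∈ W, ρ (altMap p g) v ∈ W) (g : alternatingGroup ι) (v : W) :
    (altRestrict ρ p W hW g v : V) = ρ (altMap p g) v := rfl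

end Restriction

universe u v

/-- The weak dimension bound for alternating groups of degree `m`. -/
def WeakBound (k : Type v) [Field k] (m : ℕ) : Prop :=
  ∀ (α : Type) [Fintype α] [DecidableEq α] (V : Type u) [AddCommGroup V] [Module k V]
    [FiniteDimensional k V] (ρ : Representation k (alternatingGroup α) V),
    Fintype.card α = m → MovesAll ρ → m ≤ finrank k V + 2

section Bounds

variable {α : Type} [Fintype α] [DecidableEq α]
variable {k : Type v} {V : Type u} [Field k] [AddCommGroup V] [Module k V]
  [FiniteDimensional k V] {ρ : Representation k (alternatingGroup α) V}
  {L : List (alternatingGroup α × k)}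

theorem card_le_finrank_jointEigenspace (S : Finset α)
    (hL : ∀ e ∈ L, ∀ g : alternatingGroup α, (∀ s ∈ S, (g : Perm α) s = s) → Commute g e.1)
    {a b c d : α} (hd : [a, b, c, d].Nodup) (hS : ∀ x ∈ [a, b, c, d], x ∉ S)
    {v : V} (hv : v ∈ jointEigenspace ρ L) (hne : ρ (dswap a b c d) v ≠ v) {m : ℕ}
    (hm : m + S.card = Fintype.card α) (hm6 : 6 ≤ m)
    (IH : WeakBound.{u, v} k m) : m ≤ finrank k (jointEigenspace ρ L) + 2 := by
  have hW : ∀ g, ∀ v ∈ jointEigenspace ρ L,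
      ρ (altMap (Function.Embedding.subtype (· ∉ S)) g) v ∈ jointEigenspace ρ L :=
    fun g v hv => apply_mem_jointEigenspace (fun e he => hL e he _ fun s hs =>
      altMap_apply_of_notMem _ _ (by simpa using hs)) hv
  have hcard : Fintype.card {x // x ∉ S} = m := by
    rw [Fintype.card_subtype_compl]
    simp only [Fintype.card_coe]
    omega
  refine IH {x // x ∉ S} _ (altRestrict ρ _ _ hW) hcard ?_
  simp only [List.mem_cons, List.not_mem_nil, or_false, forall_eq_or_imp, forall_eq] at hS
  refine movesAll_of_ne (hcard.symm ▸ hm6) (a := ⟨a, hS.1⟩) (b := ⟨b, hS.2.1⟩)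
    (c := ⟨c, hS.2.2.1⟩) (d := ⟨d, hS.2.2.2⟩) ?_ ?_
  · exact List.Nodup.of_map Subtype.val hd
  · intro h1
    apply hne
    have := congrArg Subtype.val (LinearMap.congr_fun h1 ⟨v, hv⟩)
    rw [altRestrict_apply_coe, altMap_dswap] at this
    exact this

end Bounds

section FourGroup

variable {G k V : Type*} [Group G] [Field k] [AddCommGroup V] [Module k V]
  [FiniteDimensional k V] {ρ : Representation k G V} {L : List (G × k)}

omit [FiniteDimensional k V] in
theorem finrank_jointEigenspace_append_conj {r : G} (hr : ∀ e ∈ L, Commute r e.1)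
    (M : List (G × k)) :
    finrank k (jointEigenspace ρ (M.map (fun e => (r * e.1 * r⁻¹, e.2)) ++ L)) =
      finrank k (jointEigenspace ρ (M ++ L)) := by
  have hL : L.map (fun e => (r * e.1 * r⁻¹, e.2)) = L := by
    conv_rhs => rw [← List.map_id L]
    refine List.map_congr_left fun e he => ?_
    rw [(hr e he).eq, mul_inv_cancel_right]
    rfl
  rw [← finrank_jointEigenspace_conj (ρ := ρ) (L := M ++ L) r, List.map_append, hL]

theorem finrank_eq_add_three_mul (h2 : (2 : k) ≠ 0) {x y r : G} (hx : x * x = 1) (hy : y * y = 1)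
    (hxy : Commute x y) (hrx : r * x * r⁻¹ = y) (hry : r * y * r⁻¹ = x * y)
    (hxL : ∀ e ∈ L, Commute x e.1) (hyL : ∀ e ∈ L, Commute y e.1) (hrL : ∀ e ∈ L, Commute r e.1) :
    finrank k (jointEigenspace ρ L) = finrank k (jointEigenspace ρ ((x, 1) :: (y, 1) :: L)) +
      3 * finrank k (jointEigenspace ρ ((x, 1) :: (y, -1) :: L)) := by
  have hrxy : r * (x * y) * r⁻¹ = x := by
    rw [show r * (x * y) * r⁻¹ = (r * x * r⁻¹) * (r * y * r⁻¹) by group, hrx, hry, hxy.eq,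
      ← mul_assoc, hy, one_mul]
  have e1 := finrank_eq_add_of_involution (ρ := ρ) h2 hy hyL
  have e2 := finrank_eq_add_of_involution (ρ := ρ) (L := (y, 1) :: L)
      h2 hx (List.forall_mem_cons.2 ⟨hxy, hxL⟩)
  have e3 := finrank_eq_add_of_involution (ρ := ρ) (L := (y, -1) :: L)
      h2 hx (List.forall_mem_cons.2 ⟨hxy, hxL⟩)
  have c1 : finrank k (jointEigenspace ρ ((r * x * r⁻¹, 1) :: (r * y * r⁻¹, -1) :: L)) =
      finrank k (jointEigenspace ρ ((x, 1) :: (y, -1) :: L)) :=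
    finrank_jointEigenspace_append_conj hrL [(x, 1), (y, -1)]
  have c2 : finrank k (jointEigenspace ρ ((r * y * r⁻¹, 1) :: (r * (x * y) * r⁻¹, -1) :: L)) =
      finrank k (jointEigenspace ρ ((y, 1) :: (x * y, -1) :: L)) :=
    finrank_jointEigenspace_append_conj hrL [(y, 1), (x * y, -1)]
  rw [hrx, hry] at c1
  rw [hry, hrxy] at c2
  have f1 : jointEigenspace ρ ((y, 1) :: (x * y, -1) :: L) =
      jointEigenspace ρ ((x, -1) :: (y, 1) :: L) := by
    ext v
    simp only [mem_jointEigenspace_cons, map_mul, Module.End.mul_apply, one_smul]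
    constructor
    · rintro ⟨h1, h3, h4⟩; rw [h1] at h3; exact ⟨h3, h1, h4⟩
    · rintro ⟨h1, h3, h4⟩; exact ⟨h3, by rw [h3, h1], h4⟩
  have f2 : jointEigenspace ρ ((x * y, 1) :: (x, -1) :: L) =
      jointEigenspace ρ ((x, -1) :: (y, -1) :: L) := by
    ext v
    rw [hxy.eq]
    simp only [mem_jointEigenspace_cons, map_mul, Module.End.mul_apply, one_smul, neg_smul]
    refine ⟨fun ⟨h1, h3, h4⟩ => ⟨h3, ?_, h4⟩, fun ⟨h1, h3, h4⟩ => ⟨?_, h1, h4⟩⟩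
    · rw [h3, map_neg] at h1; rw [← h1, neg_neg, h1]
    · rw [h1, map_neg, h3, neg_neg]
  rw [f1] at c1 c2
  rw [f2] at c2
  omega

theorem one_le_finrank_of_ne (h2 : (2 : k) ≠ 0) {x y r : G} (hx : x * x = 1) (hy : y * y = 1)
    (hxy : Commute x y) (hrx : r * x * r⁻¹ = y) (hry : r * y * r⁻¹ = x * y)
    (hxL : ∀ e ∈ L, Commute x e.1) (hyL : ∀ e ∈ L, Commute y e.1) (hrL : ∀ e ∈ L, Commute r e.1)
    {v : V} (hv : v ∈ jointEigenspace ρ L) (hne : ρ x v ≠ v) :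
    1 ≤ finrank k (jointEigenspace ρ ((x, 1) :: (y, -1) :: L)) := by
  by_contra! h0
  have := finrank_eq_add_three_mul (ρ := ρ) h2 hx hy hxy hrx hry hxL hyL hrL
  have heq : jointEigenspace ρ ((x, 1) :: (y, 1) :: L) = jointEigenspace ρ L :=
    Submodule.eq_of_le_of_finrank_eq
      (fun v hv => by simp only [mem_jointEigenspace_cons] at hv; exact hv.2.2) (by omega)
  rw [← heq] at hv
  simp only [mem_jointEigenspace_cons, one_smul] at hv
  exact hne hv.1

end FourGroup

section FourGroupLine

variable {α : Type} [Fintype α] [DecidableEq α]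
variable {k : Type v} {V : Type u} [Field k] [AddCommGroup V] [Module k V]
  [FiniteDimensional k V] {ρ : Representation k (alternatingGroup α) V}

theorem fourGroup_relations (q : Fin 4 ↪ α) :
    let x := altMap q (dswap 0 1 2 3)
    let y := altMap q (dswap 0 2 1 3)
    let r := altMap q (tricycle 1 3 2)
    x * x = 1 ∧ y * y = 1 ∧ Commute x y ∧ r * x * r⁻¹ = y ∧ r * y * r⁻¹ = x * y := by
  have h : (dswap 0 1 2 3 * dswap 0 1 2 3 : alternatingGroup (Fin 4)) = 1 ∧
      (dswap 0 2 1 3 * dswap 0 2 1 3 : alternatingGroup (Fin 4)) = 1 ∧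
      (dswap 0 1 2 3 * dswap 0 2 1 3 : alternatingGroup (Fin 4)) =
        dswap 0 2 1 3 * dswap 0 1 2 3 ∧
      (tricycle 1 3 2 * dswap 0 1 2 3 * (tricycle 1 3 2)⁻¹ : alternatingGroup (Fin 4)) =
        dswap 0 2 1 3 ∧
      (tricycle 1 3 2 * dswap 0 2 1 3 * (tricycle 1 3 2)⁻¹ : alternatingGroup (Fin 4)) =
        dswap 0 1 2 3 * dswap 0 2 1 3 := by decide
  obtain ⟨h1, h2, h3, h4, h5⟩ := h
  refine ⟨?_, ?_, ?_, ?_, ?_⟩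
  · rw [← map_mul, h1, map_one]
  · rw [← map_mul, h2, map_one]
  · exact Commute.map (show Commute _ _ from h3) _
  · rw [← map_inv, ← map_mul, ← map_mul, h4]
  · rw [← map_inv, ← map_mul, ← map_mul, ← map_mul, h5]

theorem finrank_fourGroup_eq_one (h2 : (2 : k) ≠ 0) (hcard : 7 ≤ Fintype.card α)
    (hn : finrank k V + 2 ≤ Fintype.card α) (hρ : MovesAll ρ)
    (IH : ∀ m < Fintype.card α, 7 ≤ m → WeakBound.{u, v} k m) (q : Fin 4 ↪ α) :
    finrank k (jointEigenspace ρ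
      [(altMap q (dswap 0 1 2 3), 1), (altMap q (dswap 0 2 1 3), -1)]) = 1 := by
  obtain ⟨hx, hy, hxy, hrx, hry⟩ := fourGroup_relations q
  have hxne : ∀ q : Fin 4 ↪ α, ∃ v, ρ (altMap q (dswap 0 1 2 3)) v ≠ v := fun q => by
    by_contra! H
    rw [altMap_dswap] at H
    refine hρ (q 0) (q 1) (q 2) (q 3) ?_ (LinearMap.ext H)
    exact List.Nodup.map (l := [0, 1, 2, 3]) q.injective (by decide)
  have hdim := finrank_eq_add_three_mul (ρ := ρ) (L := []) h2 hx hy hxy hrx hry (by simp) (by simp)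
    (by simp)
  have hb : 1 ≤ finrank k (jointEigenspace ρ
      [(altMap q (dswap 0 1 2 3), 1), (altMap q (dswap 0 2 1 3), -1)]) := by
    obtain ⟨v, hv⟩ := hxne q
    exact one_le_finrank_of_ne h2 hx hy hxy hrx hry (by simp) (by simp) (by simp)
      mem_jointEigenspace_nil hv
  rw [jointEigenspace_nil, finrank_top] at hdim
  rcases hcard.lt_or_eq with h8 | h7
  swap
  · omega
  obtain ⟨e⟩ : Nonempty (Fin 4 ↪ {x // x ∉ Finset.univ.map q}) :=
    Function.Embedding.nonempty_of_card_le (by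
      rw [Fintype.card_subtype_compl]
      simp only [Fintype.card_coe, Fintype.card_fin, Finset.card_map, Finset.card_univ]
      omega)
  set q' := e.trans (Function.Embedding.subtype _) with hq'
  have hdisj : ∀ i j, q' i ≠ q j := fun i j h => (e i).2 (by
    rw [Finset.mem_map]; exact ⟨j, Finset.mem_univ _, h.symm⟩)
  obtain ⟨hx', hy', hxy', hrx', hry'⟩ := fourGroup_relations q'
  have bound : ∀ r s : k, (∃ v ∈ jointEigenspace ρ
        [(altMap q (dswap 0 1 2 3), r), (altMap q (dswap 0 2 1 3), s)],
        ρ (altMap q' (dswap 0 1 2 3)) v ≠ v) →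
      3 ≤ finrank k (jointEigenspace ρ
        [(altMap q (dswap 0 1 2 3), r), (altMap q (dswap 0 2 1 3), s)]) ∧
      (11 ≤ Fintype.card α → Fintype.card α ≤ finrank k (jointEigenspace ρ
        [(altMap q (dswap 0 1 2 3), r), (altMap q (dswap 0 2 1 3), s)]) + 6) := by
    rintro r s ⟨v, hv, hne⟩
    have hc : ∀ g, ∀ f ∈ [(altMap q (dswap 0 1 2 3), r), (altMap q (dswap 0 2 1 3), s)],
        Commute (altMap q' g) f.1 := fun g f hf => by
      simp only [List.mem_cons, List.not_mem_nil, or_false] at hf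
      rcases hf with rfl | rfl <;> exact commute_altMap _ _ hdisj _ _
    constructor
    · have h1 := finrank_eq_add_three_mul (ρ := ρ) h2 hx' hy' hxy' hrx' hry' (hc _) (hc _) (hc _)
      have h3 := one_le_finrank_of_ne (ρ := ρ) h2 hx' hy' hxy' hrx' hry' (hc _) (hc _) (hc _)
        hv hne
      omega
    · intro h11
      have hle := card_le_finrank_jointEigenspace (ρ := ρ) (Finset.univ.map q)
        (L := [(altMap q (dswap 0 1 2 3), r), (altMap q (dswap 0 2 1 3), s)])
        (fun f hf g hg => by
          have hg' : ∀ i, (g : Perm α) (q i) = q i := fun i => hg _ (by simp)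
          simp only [List.mem_cons, List.not_mem_nil, or_false] at hf
          rcases hf with rfl | rfl <;> simp only [altMap_dswap] <;>
          exact commute_dswap (hg' _) (hg' _) (hg' _) (hg' _))
        (a := q' 0) (b := q' 1) (c := q' 2) (d := q' 3)
        (List.Nodup.map (l := [0, 1, 2, 3]) q'.injective (by decide))
        (by
          intro x hx
          simp only [List.mem_cons, List.not_mem_nil, or_false] at hx
          rcases hx with rfl | rfl | rfl | rfl <;> exact (e _).2) hv
        (by rwa [altMap_dswap] at hne) (m := Fintype.card α - 4) (by simp; omega) (by omega)
        (IH _ (by omega) (by omega))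
      omega
  have b1 := bound 1 (-1)
  have b0 := bound 1 1
  by_cases h1 : ∃ v ∈ jointEigenspace ρ
        [(altMap q (dswap 0 1 2 3), (1 : k)), (altMap q (dswap 0 2 1 3), -1)],
        ρ (altMap q' (dswap 0 1 2 3)) v ≠ v
  · have := b1 h1
    omega
  by_cases h0 : ∃ v ∈ jointEigenspace ρ
        [(altMap q (dswap 0 1 2 3), (1 : k)), (altMap q (dswap 0 2 1 3), 1)],
        ρ (altMap q' (dswap 0 1 2 3)) v ≠ v
  · have := b0 h0
    omega
  exfalso
  push Not at h1 h0
  have hc : ∀ g, ∀ f ∈ [(altMap q' (dswap 0 1 2 3), (1 : k))],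
      Commute (altMap q g) f.1 := fun g f hf => by
    rw [List.mem_singleton] at hf
    subst hf
    exact commute_altMap _ _ (fun i j => (hdisj j i).symm) _ _
  have hdim' := finrank_eq_add_three_mul (ρ := ρ) h2 hx hy hxy hrx hry (hc _) (hc _) (hc _)
  have e1 : ∀ r s : k, (∀ v ∈ jointEigenspace ρ
      [(altMap q (dswap 0 1 2 3), r), (altMap q (dswap 0 2 1 3), s)],
        ρ (altMap q' (dswap 0 1 2 3)) v = v) →
      jointEigenspace ρ [(altMap q (dswap 0 1 2 3), r), (altMap q (dswap 0 2 1 3), s),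
        (altMap q' (dswap 0 1 2 3), 1)] =
      jointEigenspace ρ [(altMap q (dswap 0 1 2 3), r), (altMap q (dswap 0 2 1 3), s)] := by
    intro r s H
    ext v
    refine ⟨fun h => ?_, fun h => ?_⟩
    · simp only [mem_jointEigenspace_cons] at h ⊢
      exact ⟨h.1, h.2.1, mem_jointEigenspace_nil⟩
    · have := H v h
      simp only [mem_jointEigenspace_cons] at h ⊢
      exact ⟨h.1, h.2.1, by rw [this, one_smul], mem_jointEigenspace_nil⟩
  rw [e1 _ _ h1, e1 _ _ h0, ← hdim] at hdim'
  have htop := Submodule.eq_top_of_finrank_eq hdim'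
  obtain ⟨v, hv⟩ := hxne q'
  have : v ∈ jointEigenspace ρ [(altMap q' (dswap 0 1 2 3), (1 : k))] := htop ▸ Submodule.mem_top
  rw [mem_jointEigenspace_cons, one_smul] at this
  exact hv this.1

end FourGroupLine

section Propagation

variable {α : Type}

/-- A symmetric relation which propagates from disjoint pairs to further pairs is full. -/
theorem rel_of_propagation {P : α → Prop} {N : α → α → Prop} (hsymm : ∀ x y, N x y → N y x)
    (hN : ∀ x y z u v, [x, y, z, u, v].Nodup → (∀ t ∈ [x, y, z, u, v], P t) →
      N x y → N z u → N z v)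
    {a b c d e : α} (hd : [a, b, c, d, e].Nodup) (hP : ∀ t ∈ [a, b, c, d, e], P t)
    (hab : N a b) (hcd : N c d) {x y : α} (hxy : x ≠ y) (hx : P x) (hy : P y) : N x y := by
  have hN' : ∀ x y z u v, [x, y, z, u, v].Nodup → P x → P y → P z → P u → P v →
      N x y → N z u → N z v := fun x y z u v h p1 p2 p3 p4 p5 =>
    hN x y z u v h (by simp [p1, p2, p3, p4, p5])
  simp only [List.nodup_cons, List.mem_cons, List.not_mem_nil, or_false, not_or, forall_eq_or_imp,
    forall_eq, List.nodup_nil, and_true, not_false_eq_true] at hd hP hN'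
  obtain ⟨⟨ab, ac, ad, ae⟩, ⟨bc, bd, be⟩, ⟨cd, ce⟩, de⟩ := hd
  obtain ⟨pa, pb, pc, pd, pe⟩ := hP
  have hce : N c e := hN' a b c d e (by tauto) pa pb pc pd pe hab hcd
  have hde : N d e := hN' a b d c e (by tauto) pa pb pd pc pe hab (hsymm _ _ hcd)
  have hae : N a e := hN' c d a b e (by tauto) pc pd pa pb pe hcd hab
  have hbe : N b e := hN' c d b a e (by tauto) pc pd pb pa pe hcd (hsymm _ _ hab)
  have hac : N a c := hN' d e a b c (by tauto) pd pe pa pb pc hde hab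
  have hbc : N b c := hN' d e b a c (by tauto) pd pe pb pa pc hde (hsymm _ _ hab)
  have had : N a d := hN' c e a b d (by tauto) pc pe pa pb pd hce hab
  have hbd : N b d := hN' c e b a d (by tauto) pc pe pb pa pd hce (hsymm _ _ hab)
  have key : ∀ s t, s ∈ [a, b, c, d, e] → P t → s ≠ t → N s t := by
    intro s t hs ht hst
    by_cases htS : t ∈ [a, b, c, d, e]
    · simp only [List.mem_cons, List.not_mem_nil, or_false] at hs htS
      rcases hs with rfl | rfl | rfl | rfl | rfl <;>
      rcases htS with rfl | rfl | rfl | rfl | rfl <;>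
      first | assumption | (apply hsymm; assumption) | exact absurd rfl hst
    · simp only [List.mem_cons, List.not_mem_nil, or_false, not_or] at hs htS
      rcases hs with rfl | rfl | rfl | rfl | rfl
      · exact hN' c d s b t (by tauto) pc pd pa pb ht hcd hab
      · exact hN' c d s a t (by tauto) pc pd pb pa ht hcd (hsymm _ _ hab)
      · exact hN' a b s d t (by tauto) pa pb pc pd ht hab hcd
      · exact hN' a b s c t (by tauto) pa pb pd pc ht hab (hsymm _ _ hcd)
      · exact hN' a b s c t (by tauto) pa pb pe pc ht hab (hsymm _ _ hce)
  by_cases hxS : x ∈ [a, b, c, d, e]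
  · exact key x y hxS hy hxy
  by_cases hyS : y ∈ [a, b, c, d, e]
  · exact hsymm _ _ (key y x hyS hx hxy.symm)
  · have := hsymm _ _ (key c x (by simp) hx (by rintro rfl; simp at hxS))
    simp only [List.mem_cons, List.not_mem_nil, or_false, not_or] at hxS hyS
    exact hN' a b x c y (by tauto) pa pb hx pc hy hab this

end Propagation

section OddCharacteristic

variable {k V : Type*} [Field k] [AddCommGroup V] [Module k V]

theorem apply_apply_of_mul_eq {G : Type*} [Group G] {ρ : Representation k G V} {g h g' h' : G}
    (e : g * h = g' * h') (v : V) : ρ g (ρ h v) = ρ g' (ρ h' v) := by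
  rw [← Module.End.mul_apply, ← Module.End.mul_apply, ← map_mul, ← map_mul, e]

/-- An operator of order three on a line is trivial if some involution inverts it. -/
theorem apply_eq_self_of_finrank_eq_one {W : Submodule k V} (hW : finrank k W = 1)
    (C T : V →ₗ[k] V) (hC : ∀ v ∈ W, C v ∈ W) (hT : ∀ v ∈ W, T v ∈ W)
    (hC3 : ∀ v, C (C (C v)) = v) (hCTC : ∀ v, C (T (C v)) = T v) (hTT : ∀ v, T (T v) = v) :
    ∀ v ∈ W, C v = v := by
  obtain ⟨r, hr⟩ := exists_smul_of_finrank_eq_one hW C hC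
  obtain ⟨e, he, he0⟩ := exists_ne_zero_of_finrank_eq_one hW
  have e1 := hC3 e
  rw [hr e he, map_smul, map_smul, hr e he, map_smul, hr e he, smul_smul, smul_smul] at e1
  have e2 := congrArg T (hCTC e)
  rw [hr e he, map_smul, map_smul, hr _ (hT e he), map_smul, map_smul, hTT, smul_smul] at e2
  have r2 : r * r = 1 := smul_left_injective k he0 (e2.trans (one_smul k e).symm)
  have r3 : r * r * r = 1 := smul_left_injective k he0
    ((by simpa [mul_assoc] using e1 : (r * r * r) • e = e).trans (one_smul k e).symm)
  rw [r2, one_mul] at r3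
  intro v hv
  rw [hr v hv, r3, one_smul]

variable {σ : Representation k (alternatingGroup (Fin 7)) V}

theorem tricycle_apply_of_finrank_eq_one (h2 : (2 : k) ≠ 0)
    (h1 : finrank k (jointEigenspace σ [(dswap 0 1 2 3, 1), (dswap 0 2 1 3, -1)]) = 1) {v : V}
    (hv : σ (dswap 0 1 2 3) v = -v) : σ (tricycle 4 5 6) v = v := by
  have hrel : (dswap 0 1 2 3 * dswap 0 1 4 5 : alternatingGroup (Fin 7)) =
        dswap 0 1 4 5 * dswap 0 1 2 3 ∧
      (dswap 0 2 1 3 * dswap 0 1 4 5 : alternatingGroup (Fin 7)) =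
        dswap 0 1 4 5 * (dswap 0 2 1 3 * dswap 0 1 2 3) ∧
      (tricycle 4 5 6 * (dswap 0 1 4 5 * tricycle 4 5 6) : alternatingGroup (Fin 7)) =
        dswap 0 1 4 5 ∧
      (tricycle 4 5 6 * (tricycle 4 5 6 * tricycle 4 5 6) : alternatingGroup (Fin 7)) = 1 ∧
      (dswap 0 1 2 3 * tricycle 4 5 6 : alternatingGroup (Fin 7)) =
        tricycle 4 5 6 * dswap 0 1 2 3 ∧
      (dswap 0 2 1 3 * tricycle 4 5 6 : alternatingGroup (Fin 7)) =
        tricycle 4 5 6 * dswap 0 2 1 3 ∧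
      (tricycle 4 5 6 * tricycle 1 3 2 : alternatingGroup (Fin 7)) =
        tricycle 1 3 2 * tricycle 4 5 6 ∧
      (dswap 0 1 2 3 * tricycle 1 3 2 : alternatingGroup (Fin 7)) =
        tricycle 1 3 2 * (dswap 0 1 2 3 * dswap 0 2 1 3) ∧
      (dswap 0 2 1 3 * tricycle 1 3 2 : alternatingGroup (Fin 7)) =
        tricycle 1 3 2 * dswap 0 1 2 3 ∧
      (tricycle 1 3 2 * (tricycle 1 3 2 * tricycle 1 3 2) : alternatingGroup (Fin 7)) = 1 ∧
      (dswap 0 2 1 3 * dswap 0 2 1 3 : alternatingGroup (Fin 7)) = 1 ∧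
      (dswap 0 1 2 3 * dswap 0 2 1 3 : alternatingGroup (Fin 7)) =
        dswap 0 2 1 3 * dswap 0 1 2 3 ∧
      (dswap 0 1 4 5 * dswap 0 1 4 5 : alternatingGroup (Fin 7)) = 1 := by decide
  set X := σ (dswap 0 1 2 3)
  set Y := σ (dswap 0 2 1 3)
  set T := σ (dswap 0 1 4 5)
  set C := σ (tricycle 4 5 6)
  set R := σ (tricycle 1 3 2)
  obtain ⟨hXT, hYT, hCTC, hC3, hXC, hYC, hCR, hXR, hYR, hR3, hYY, hXY, hTT⟩ :
      (∀ v, X (T v) = T (X v)) ∧ (∀ v, Y (T v) = T (Y (X v))) ∧ (∀ v, C (T (C v)) = T v) ∧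
      (∀ v, C (C (C v)) = v) ∧ (∀ v, X (C v) = C (X v)) ∧ (∀ v, Y (C v) = C (Y v)) ∧
      (∀ v, C (R v) = R (C v)) ∧ (∀ v, X (R v) = R (X (Y v))) ∧ (∀ v, Y (R v) = R (X v)) ∧
      (∀ v, R (R (R v)) = v) ∧ (∀ v, Y (Y v) = v) ∧ (∀ v, X (Y v) = Y (X v)) ∧
      ∀ v, T (T v) = v := by
    have hrel' := And.imp (congrArg σ) (And.imp (congrArg σ) (And.imp (congrArg σ)
      (And.imp (congrArg σ) (And.imp (congrArg σ) (And.imp (congrArg σ) (And.imp (congrArg σ)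
      (And.imp (congrArg σ) (And.imp (congrArg σ) (And.imp (congrArg σ) (And.imp (congrArg σ)
      (And.imp (congrArg σ) (congrArg σ)))))))))))) hrel
    simp only [map_mul, map_one] at hrel'
    obtain ⟨h1, h2, h3, h4, h5, h6, h7, h8, h9, h10, h11, h12, h13⟩ := hrel'
    exact ⟨LinearMap.congr_fun h1, LinearMap.congr_fun h2, LinearMap.congr_fun h3,
      LinearMap.congr_fun h4, LinearMap.congr_fun h5, LinearMap.congr_fun h6,
      LinearMap.congr_fun h7, LinearMap.congr_fun h8, LinearMap.congr_fun h9,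
      LinearMap.congr_fun h10, LinearMap.congr_fun h11, LinearMap.congr_fun h12,
      LinearMap.congr_fun h13⟩
  have hmem : ∀ v, v ∈ jointEigenspace σ [(dswap 0 1 2 3, 1), (dswap 0 2 1 3, -1)] ↔
      X v = v ∧ Y v = -v := fun v => by
    simp only [mem_jointEigenspace_cons, one_smul, neg_smul, mem_jointEigenspace_nil, and_true]
    rfl
  have hV1 : ∀ v, X v = v → Y v = -v → C v = v := by
    intro v hX hY
    refine apply_eq_self_of_finrank_eq_one h1 C T (fun v hv => ?_) (fun v hv => ?_) hC3 hCTC hTT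
      v ((hmem v).2 ⟨hX, hY⟩)
    · rw [hmem] at hv ⊢
      rw [hXC, hYC, hv.1, hv.2, map_neg]
      exact ⟨rfl, rfl⟩
    · rw [hmem] at hv ⊢
      rw [hXT, hYT, hv.1, hv.2, map_neg]
      exact ⟨rfl, rfl⟩
  have hV3 : ∀ v, X v = -v → Y v = -v → C v = v := fun v hX hY => by
    have := hV1 (R v) (by rw [hXR, hY, map_neg, hX, neg_neg]) (by rw [hYR, hX, map_neg])
    rw [← hR3 v, hCR, hCR, this]
  have hV2 : ∀ v, X v = -v → Y v = v → C v = v := fun v hX hY => by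
    have := hV3 (R v) (by rw [hXR, hY, hX, map_neg]) (by rw [hYR, hX, map_neg])
    rw [← hR3 v, hCR, hCR, this]
  have h3 := hV2 (v + Y v) (by rw [map_add, hXY, hv, map_neg, neg_add]) (by
    rw [map_add, hYY, add_comm])
  have h4 := hV3 (v - Y v) (by rw [map_sub, hXY, hv, map_neg]; abel) (by
    rw [map_sub, hYY]; abel)
  have h5 : (2 : k) • C v = (2 : k) • v := by
    rw [map_add] at h3
    rw [map_sub] at h4
    linear_combination (norm := module) h3 + h4
  exact smul_right_injective V h2 h5

end OddCharacteristic

section OddCharacteristicStandard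

variable {k V : Type*} [Field k] [AddCommGroup V] [Module k V]

theorem exists_common_neg_of_finrank_eq_one
    {σ : Representation k (alternatingGroup (Fin 7)) V} (h2 : (2 : k) ≠ 0)
    (h1 : finrank k (jointEigenspace σ [(dswap 0 1 2 3, 1), (dswap 0 2 1 3, -1)]) = 1) :
    ∃ w ≠ 0, σ (dswap 0 1 2 3) w = -w ∧ σ (dswap 0 1 4 5) w = -w := by
  obtain ⟨v, hv, hv0⟩ := exists_ne_zero_of_finrank_eq_one h1
  simp only [mem_jointEigenspace_cons, one_smul, neg_smul, mem_jointEigenspace_nil,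
    and_true] at hv
  have hrel : (dswap 0 1 2 3 * dswap 0 1 4 5 : alternatingGroup (Fin 7)) =
        dswap 0 1 4 5 * dswap 0 1 2 3 ∧
      (dswap 0 2 1 3 * dswap 0 1 4 5 : alternatingGroup (Fin 7)) =
        dswap 0 1 4 5 * (dswap 0 2 1 3 * dswap 0 1 2 3) ∧
      (dswap 0 1 2 3 * tricycle 1 3 2 : alternatingGroup (Fin 7)) =
        tricycle 1 3 2 * (dswap 0 1 2 3 * dswap 0 2 1 3) ∧
      (dswap 0 2 1 3 * tricycle 1 3 2 : alternatingGroup (Fin 7)) =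
        tricycle 1 3 2 * dswap 0 1 2 3 ∧
      (dswap 0 1 4 5 * dswap 0 1 4 5 : alternatingGroup (Fin 7)) = 1 := by decide
  have hrel' := And.imp (congrArg σ) (And.imp (congrArg σ) (And.imp (congrArg σ)
    (And.imp (congrArg σ) (congrArg σ)))) hrel
  simp only [map_mul, map_one] at hrel'
  obtain ⟨hXT, hYT, hXR, hYR, hTT⟩ := hrel'
  replace hXT := LinearMap.congr_fun hXT
  replace hYT := LinearMap.congr_fun hYT
  replace hXR := LinearMap.congr_fun hXR
  replace hYR := LinearMap.congr_fun hYR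
  replace hTT := LinearMap.congr_fun hTT
  simp only [Module.End.mul_apply, Module.End.one_apply] at hXT hYT hXR hYR hTT
  have hu0 : σ (tricycle 1 3 2) v ≠ 0 := fun h => hv0 (by
    have := congrArg (σ (tricycle 1 3 2)⁻¹) h
    rwa [apply_inv_apply, map_zero] at this)
  set u := σ (tricycle 1 3 2) v
  have hXu : σ (dswap 0 1 2 3) u = -u := by rw [hXR, hv.2, map_neg, hv.1, map_neg]
  have hYu : σ (dswap 0 2 1 3) u = u := by rw [hYR, hv.1]
  refine ⟨u - σ (dswap 0 1 4 5) u, fun h => ?_, ?_, ?_⟩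
  · have h3 := hYT u
    rw [hXu, map_neg, hYu, map_neg, ← sub_eq_zero.1 h, hYu] at h3
    have : (2 : k) • u = 0 := by linear_combination (norm := module) h3
    exact hu0 ((smul_eq_zero.1 this).resolve_left h2)
  · rw [map_sub, hXT, hXu, map_neg]
    abel
  · rw [map_sub, hTT]
    abel

theorem cycle_sum_eq_zero {σ : Representation k (alternatingGroup (Fin 7)) V} (h2 : (2 : k) ≠ 0)
    (hfix : ∀ v, σ (dswap 0 1 3 4) v = -v → σ (tricycle 2 5 6) v = v) {w : V}
    (h34 : σ (dswap 0 1 3 4) w = -w) (h56 : σ (dswap 0 1 5 6) w = -w) :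
    w + σ (tricycle 0 1 2) w + σ (tricycle 0 1 2) (σ (tricycle 0 1 2) w) = 0 := by
  have hrel : (dswap 0 1 3 4 * tricycle 0 1 2 : alternatingGroup (Fin 7)) =
        tricycle 0 1 2 * (tricycle 0 1 2 * dswap 0 1 3 4) ∧
      (dswap 0 1 5 6 * tricycle 0 1 2 : alternatingGroup (Fin 7)) =
        tricycle 0 1 2 * (tricycle 0 1 2 * dswap 0 1 5 6) ∧
      (tricycle 0 1 2 * (tricycle 0 1 2 * tricycle 0 1 2) : alternatingGroup (Fin 7)) = 1 ∧
      (tricycle 0 1 2 * (tricycle 2 5 6 * (tricycle 0 1 2 * (tricycle 2 5 6 *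
        (dswap 0 1 3 4 * dswap 0 1 5 6)))) : alternatingGroup (Fin 7)) =
        dswap 0 1 3 4 * (tricycle 0 1 2 * (tricycle 2 5 6 * (tricycle 0 1 2 *
          tricycle 2 5 6))) := by decide
  have hrel' := And.imp (congrArg σ) (And.imp (congrArg σ) (And.imp (congrArg σ)
    (congrArg σ))) hrel
  simp only [map_mul, map_one] at hrel'
  obtain ⟨hT, hT', hC3, hw⟩ := hrel'
  replace hT := LinearMap.congr_fun hT
  replace hT' := LinearMap.congr_fun hT'
  replace hC3 := LinearMap.congr_fun hC3
  replace hw := LinearMap.congr_fun hw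
  simp only [Module.End.mul_apply, Module.End.one_apply] at hT hT' hC3 hw
  set s := w + σ (tricycle 0 1 2) w + σ (tricycle 0 1 2) (σ (tricycle 0 1 2) w) with hs
  have s34 : σ (dswap 0 1 3 4) s = -s := by
    simp only [hs, map_add, hT, h34, map_neg, hC3]
    abel
  have s56 : σ (dswap 0 1 5 6) s = -s := by
    simp only [hs, map_add, hT', h56, map_neg, hC3]
    abel
  have sC : σ (tricycle 0 1 2) s = s := by
    simp only [hs, map_add, hC3]
    abel
  have h3 := hw s
  simp only [s56, s34, map_neg, neg_neg, hfix s s34, sC] at h3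
  have : (2 : k) • s = 0 := by linear_combination (norm := module) h3
  exact (smul_eq_zero.1 this).resolve_left h2

end OddCharacteristicStandard


section

variable {α : Type} [Fintype α] [DecidableEq α]
variable {k : Type v} {V : Type u} [Field k] [AddCommGroup V] [Module k V]
  [FiniteDimensional k V] {ρ : Representation k (alternatingGroup α) V}

omit [FiniteDimensional k V] in
theorem apply_neg_of_conj {a b x y z : α} (hxa : a ≠ x) (hxb : b ≠ x) (hya : a ≠ y) (hyb : b ≠ y)
    (hza : a ≠ z) (hzb : b ≠ z) (hxy : x ≠ y) (hxz : x ≠ z) (hyz : y ≠ z) {w r : V}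
    (hw : ρ (dswap a b x y) w = r) (hfix : ρ (tricycle x y z) w = w)
    (hr : ρ (tricycle x y z) r = r) : ρ (dswap a b x z) w = r := by
  have hc := coe_dswap hxy hxz
  have h1 := conj_dswap (tricycle x y z) a b y x
  rw [dswap_apply_of_ne hxa hya hxa hza, dswap_apply_of_ne hxb hyb hxb hzb,
    show (tricycle x y z : Perm α) x = z by
      simp [hc, swap_apply_of_ne_of_ne hxz.symm hyz.symm],
    show (tricycle x y z : Perm α) y = x by
      simp [hc, swap_apply_of_ne_of_ne hxy.symm hyz]] at h1
  have h3 : dswap a b x z * tricycle x y z = tricycle x y z * dswap a b x y := by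
    rw [← h1, inv_mul_cancel_right]
    congr 1
    simp only [dswap, swap_comm y x, eq_comm (a := y) (b := x)]
  have h4 := apply_apply_of_mul_eq (ρ := ρ) h3 w
  rwa [hfix, hw, hr] at h4

theorem exists_isStandardVector_of_two_ne_zero (h2 : (2 : k) ≠ 0) (hcard : 7 ≤ Fintype.card α)
    (hn : finrank k V + 2 ≤ Fintype.card α) (hρ : MovesAll ρ)
    (IH : ∀ m < Fintype.card α, 7 ≤ m → WeakBound.{u, v} k m) :
    ∃ a b c w, [a, b, c].Nodup ∧ IsStandardVector ρ a b c w := by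
  have hline : ∀ p : Fin 7 ↪ α, finrank k (jointEigenspace (ρ.comp (altMap p))
      [(dswap 0 1 2 3, 1), (dswap 0 2 1 3, -1)]) = 1 := fun p => by
    have heq : jointEigenspace (ρ.comp (altMap p)) [(dswap 0 1 2 3, 1), (dswap 0 2 1 3, -1)] =
        jointEigenspace ρ
          [(altMap ((Fin.castLEEmb (by decide : 4 ≤ 7)).trans p) (dswap 0 1 2 3), 1),
            (altMap ((Fin.castLEEmb (by decide : 4 ≤ 7)).trans p) (dswap 0 2 1 3), -1)] := by
      ext v
      simp only [mem_jointEigenspace_cons, MonoidHom.comp_apply, altMap_dswap,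
        mem_jointEigenspace_nil, and_true]
      rfl
    rw [heq]
    exact finrank_fourGroup_eq_one h2 hcard hn hρ IH _
  have hfix : ∀ {a b x y z u v : α}, [a, b, x, y, z, u, v].Nodup → ∀ w,
      ρ (dswap a b x y) w = -w → ρ (tricycle z u v) w = w := by
    intro a b x y z u v hd w hw
    have := tricycle_apply_of_finrank_eq_one h2 (hline ⟨_, hd.injective_get⟩) (v := w)
    simp only [MonoidHom.comp_apply, altMap_dswap] at this
    exact this hw
  obtain ⟨p⟩ : Nonempty (Fin 7 ↪ α) := Function.Embedding.nonempty_of_card_le (by simpa)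
  obtain ⟨w, hw0, hw1, hw2⟩ := exists_common_neg_of_finrank_eq_one h2 (hline p)
  simp only [MonoidHom.comp_apply, altMap_dswap] at hw1 hw2
  have hneg : ∀ x y, x ≠ y → x ≠ p 0 ∧ x ≠ p 1 → y ≠ p 0 ∧ y ≠ p 1 →
      ρ (dswap (p 0) (p 1) x y) w = -w := by
    intro x y hxy hx hy
    refine rel_of_propagation (P := fun x => x ≠ p 0 ∧ x ≠ p 1)
      (N := fun x y => ρ (dswap (p 0) (p 1) x y) w = -w) (a := p 2) (b := p 3) (c := p 4)
      (d := p 5) (e := p 6) ?_ ?_ ?_ ?_ hw1 hw2 hxy hx hy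
    · intro x y h
      rw [← h]
      congr 2
      simp only [dswap, swap_comm y x, eq_comm (a := y) (b := x)]
    · intro x y z u v hd hP hxy hzu
      simp only [List.nodup_cons, List.mem_cons, List.not_mem_nil, or_false, not_or,
        forall_eq_or_imp, forall_eq, List.nodup_nil, and_true, not_false_eq_true] at hd hP
      have h01 : p 0 ≠ p 1 := p.injective.ne (by decide)
      have hf := hfix (a := p 0) (b := p 1) (x := x) (y := y) (z := z) (u := u) (v := v)
        (by simp only [List.nodup_cons, List.mem_cons, List.not_mem_nil, or_false, not_or,
              List.nodup_nil, and_true, not_false_eq_true]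
            grind) w hxy
      exact apply_neg_of_conj (by tauto) (by tauto) (by tauto) (by tauto) (by tauto) (by tauto)
        (by tauto) (by tauto) (by tauto) hzu hf (by rw [map_neg, hf])
    · exact List.Nodup.map (l := [2, 3, 4, 5, 6]) p.injective (by decide)
    · intro t ht
      have : t ∈ [2, 3, 4, 5, 6].map p := ht
      obtain ⟨i, hi, rfl⟩ := List.mem_map.1 this
      simp only [p.injective.ne_iff]
      clear ht this
      revert i
      decide
  refine ⟨p 0, p 1, p 2, w, List.Nodup.map (l := [0, 1, 2]) p.injective (by decide), hw0,
    fun x y hxy h1 h2 h3 h4 => hneg x y hxy ⟨h1, h2⟩ ⟨h3, h4⟩, ?_⟩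
  have hp : ∀ i : Fin 7, i ≠ 0 → i ≠ 1 → p i ≠ p 0 ∧ p i ≠ p 1 := fun i h0 h1 =>
    ⟨p.injective.ne h0, p.injective.ne h1⟩
  have := cycle_sum_eq_zero (σ := ρ.comp (altMap p)) h2 (fun v hv => ?_) (w := w) ?_ ?_
  · simpa only [MonoidHom.comp_apply, altMap_dswap] using this
  · simp only [MonoidHom.comp_apply, altMap_dswap] at hv ⊢
    exact hfix (List.Nodup.map (l := [0, 1, 3, 4, 2, 5, 6]) p.injective (by decide)) v hv
  · simp only [MonoidHom.comp_apply, altMap_dswap]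
    exact hneg _ _ (p.injective.ne (by decide)) (hp _ (by decide) (by decide))
      (hp _ (by decide) (by decide))
  · simp only [MonoidHom.comp_apply, altMap_dswap]
    exact hneg _ _ (p.injective.ne (by decide)) (hp _ (by decide) (by decide))
      (hp _ (by decide) (by decide))

end

section ThreeCycles

theorem jointEigenspace_comp {G H k V : Type*} [Group G] [Group H] [Field k] [AddCommGroup V]
    [Module k V] (ρ : Representation k G V) (f : H →* G) (L : List (H × k)) :
    jointEigenspace (ρ.comp f) L = jointEigenspace ρ (L.map fun e => (f e.1, e.2)) := by
  ext v
  induction L with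
  | nil => simp
  | cons e L ih =>
    rw [List.map_cons, mem_jointEigenspace_cons, mem_jointEigenspace_cons, ih]
    rfl

theorem inv_apply_eq_smul_iff {G k V : Type*} [Group G] [Field k] [AddCommGroup V] [Module k V]
    {ρ : Representation k G V} {g : G} {r : k} (hr : r ≠ 0) (v : V) :
    ρ g⁻¹ v = r⁻¹ • v ↔ ρ g v = r • v := by
  have := SetLike.ext_iff.1 (jointEigenspace_inv (ρ := ρ) (g := g) (L := []) hr) v
  simpa only [mem_jointEigenspace_cons, mem_jointEigenspace_nil, and_true] using this

theorem eq_of_signedSymm {F : Fin 3 → Fin 3 → Fin 3 → ℕ}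
    (h1 : ∀ i j l, F i (-j) (-l) = F i j l) (h2 : ∀ i j l, F l i j = F i j l)
    (h3 : ∀ i j l, F (-i) l j = F i j l) :
    (∀ i j l, i = 0 → j ≠ 0 → l ≠ 0 → F i j l = F 0 1 1) ∧
    (∀ i j l, i ≠ 0 → j = 0 → l ≠ 0 → F i j l = F 0 1 1) ∧
    (∀ i j l, i ≠ 0 → j ≠ 0 → l = 0 → F i j l = F 0 1 1) ∧
    (∀ i j l, i ≠ 0 → j ≠ 0 → l ≠ 0 → F i j l = F 1 1 1) ∧
    (∀ i j l, i ≠ 0 → j = 0 → l = 0 → F i j l = F 0 0 1) ∧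
    (∀ i j l, i = 0 → j ≠ 0 → l = 0 → F i j l = F 0 0 1) ∧
    (∀ i j l, i = 0 → j = 0 → l ≠ 0 → F i j l = F 0 0 1) := by
  have e1 : (-1 : Fin 3) = 2 := by decide
  have e2 : (-2 : Fin 3) = 1 := by decide
  simp only [Fin.forall_fin_succ, Fin.forall_fin_zero, Fin.isValue, Fin.succ_zero_eq_one,
    Fin.succ_one_eq_two, neg_zero, e1, e2] at h1 h2 h3
  refine ⟨?_, ?_, ?_, ?_, ?_, ?_, ?_⟩ <;> intro i j l hi hj hl <;>
  fin_cases i <;> fin_cases j <;> fin_cases l <;>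
  simp only [Fin.isValue, Fin.zero_eta, Fin.mk_one, Fin.reduceFinMk, ne_eq, not_true_eq_false,
    Fin.reduceEq, not_false_eq_true] at hi hj hl ⊢ <;> omega

variable {k V : Type*} [Field k] [CharP k 2] [AddCommGroup V] [Module k V]
  [FiniteDimensional k V] {σ : Representation k (alternatingGroup (Fin 9)) V} {w : k}

/-- Dimensions of joint eigenspaces of three disjoint 3-cycles in characteristic two. -/
theorem exists_threeCycle_dims (hw : w ^ 2 + w + 1 = 0) : ∃ d0 d1 d2 d3 : ℕ,
    finrank k V = d0 + 6 * d1 + 12 * d2 + 8 * d3 ∧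
    finrank k (jointEigenspace σ [(tricycle 3 4 5, 1)]) = d0 + 4 * d1 + 4 * d2 ∧
    finrank k (jointEigenspace σ [(tricycle 3 4 5, w)]) = d1 + 4 * d2 + 4 * d3 ∧
    finrank k (jointEigenspace σ [(tricycle 3 4 5, w ^ 2)]) = d1 + 4 * d2 + 4 * d3 ∧
    finrank k (jointEigenspace σ [(tricycle 0 1 2, 1), (tricycle 3 4 5, w)]) = d1 + 2 * d2 ∧
    finrank k (jointEigenspace σ [(tricycle 0 1 2, w), (tricycle 3 4 5, w)]) = d2 + 2 * d3 ∧
    finrank k (jointEigenspace σ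
      [(tricycle 6 7 8, 1), (tricycle 0 1 2, w), (tricycle 3 4 5, w)]) = d2 := by
  have hw3 : w ^ 3 = 1 := by linear_combination (w - 1) * hw
  have hw0 : w ≠ 0 := by rintro rfl; simp at hw
  have hwi : w⁻¹ = w ^ 2 := inv_eq_of_mul_eq_one_right (by rw [← hw3]; ring)
  let E : Fin 3 → k := ![1, w, w ^ 2]
  have hE0 : ∀ i, E i ≠ 0 := by
    intro i; fin_cases i <;> simp [E, hw0]
  have hEi : ∀ i, (E i)⁻¹ = E (-i) := by
    intro i
    fin_cases i
    · simp [E]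
    · exact hwi
    · exact (inv_eq_iff_eq_inv.2 hwi.symm)
  let F : Fin 3 → Fin 3 → Fin 3 → ℕ := fun i j l => finrank k (jointEigenspace σ
    [(tricycle 6 7 8, E i), (tricycle 0 1 2, E j), (tricycle 3 4 5, E l)])
  have hconj : (dswap 0 1 3 4 * tricycle 6 7 8 * (dswap 0 1 3 4)⁻¹ : alternatingGroup (Fin 9)) =
        tricycle 6 7 8 ∧
      (dswap 0 1 3 4 * tricycle 0 1 2 * (dswap 0 1 3 4)⁻¹ : alternatingGroup (Fin 9)) =
        (tricycle 0 1 2)⁻¹ ∧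
      (dswap 0 1 3 4 * tricycle 3 4 5 * (dswap 0 1 3 4)⁻¹ : alternatingGroup (Fin 9)) =
        (tricycle 3 4 5)⁻¹ ∧
      (dswap 0 3 1 4 * dswap 2 5 6 7 * tricycle 6 7 8 * (dswap 0 3 1 4 * dswap 2 5 6 7)⁻¹ :
        alternatingGroup (Fin 9)) = (tricycle 6 7 8)⁻¹ ∧
      (dswap 0 3 1 4 * dswap 2 5 6 7 * tricycle 0 1 2 * (dswap 0 3 1 4 * dswap 2 5 6 7)⁻¹ :
        alternatingGroup (Fin 9)) = tricycle 3 4 5 ∧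
      (dswap 0 3 1 4 * dswap 2 5 6 7 * tricycle 3 4 5 * (dswap 0 3 1 4 * dswap 2 5 6 7)⁻¹ :
        alternatingGroup (Fin 9)) = tricycle 0 1 2 := by decide
  have hrot : ((tricycle 6 3 0 * tricycle 7 4 1 * tricycle 8 5 2) * tricycle 6 7 8 *
        (tricycle 6 3 0 * tricycle 7 4 1 * tricycle 8 5 2)⁻¹ : alternatingGroup (Fin 9)) =
        tricycle 0 1 2 ∧
      ((tricycle 6 3 0 * tricycle 7 4 1 * tricycle 8 5 2) * tricycle 0 1 2 *
        (tricycle 6 3 0 * tricycle 7 4 1 * tricycle 8 5 2)⁻¹ : alternatingGroup (Fin 9)) =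
        tricycle 3 4 5 ∧
      ((tricycle 6 3 0 * tricycle 7 4 1 * tricycle 8 5 2) * tricycle 3 4 5 *
        (tricycle 6 3 0 * tricycle 7 4 1 * tricycle 8 5 2)⁻¹ : alternatingGroup (Fin 9)) =
        tricycle 6 7 8 := by decide
  have h1 : ∀ i j l, F i (-j) (-l) = F i j l := fun i j l => by
    change finrank k (jointEigenspace σ [_, _, _]) = finrank k (jointEigenspace σ [_, _, _])
    rw [← finrank_jointEigenspace_conj (dswap 0 1 3 4)]
    refine congrArg (fun W : Submodule k V => finrank k W) (Submodule.ext fun v => ?_)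
    simp only [List.map_cons, List.map_nil, hconj, mem_jointEigenspace_cons, ← hEi,
      inv_apply_eq_smul_iff (hE0 _)]
  have h2 : ∀ i j l, F i j l = F l i j := fun i j l => by
    change finrank k (jointEigenspace σ [_, _, _]) = finrank k (jointEigenspace σ [_, _, _])
    rw [← finrank_jointEigenspace_conj (tricycle 6 3 0 * tricycle 7 4 1 * tricycle 8 5 2)]
    refine congrArg (fun W : Submodule k V => finrank k W) (Submodule.ext fun v => ?_)
    simp only [List.map_cons, List.map_nil, hrot, mem_jointEigenspace_cons]
    tauto
  have h3 : ∀ i j l, F (-i) l j = F i j l := fun i j l => by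
    change finrank k (jointEigenspace σ [_, _, _]) = finrank k (jointEigenspace σ [_, _, _])
    rw [← finrank_jointEigenspace_conj (dswap 0 3 1 4 * dswap 2 5 6 7)]
    refine congrArg (fun W : Submodule k V => finrank k W) (Submodule.ext fun v => ?_)
    simp only [List.map_cons, List.map_nil, hconj, mem_jointEigenspace_cons, ← hEi,
      inv_apply_eq_smul_iff (hE0 _)]
    tauto
  have hrel : (tricycle 6 7 8 ^ 3 : alternatingGroup (Fin 9)) = 1 ∧
    (tricycle 0 1 2 ^ 3 : alternatingGroup (Fin 9)) = 1 ∧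
    (tricycle 3 4 5 ^ 3 : alternatingGroup (Fin 9)) = 1 ∧
    (tricycle 6 7 8 * tricycle 0 1 2 : alternatingGroup (Fin 9)) =
      tricycle 0 1 2 * tricycle 6 7 8 ∧
    (tricycle 6 7 8 * tricycle 3 4 5 : alternatingGroup (Fin 9)) =
      tricycle 3 4 5 * tricycle 6 7 8 ∧
    (tricycle 0 1 2 * tricycle 3 4 5 : alternatingGroup (Fin 9)) =
      tricycle 3 4 5 * tricycle 0 1 2 := by decide
  obtain ⟨c1, c2, c3, c12, c13, c23⟩ := hrel
  have s3 := finrank_eq_add_of_cubic (ρ := σ) (L := []) hw c3 (by simp)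
  have s2 : ∀ l, _ := fun l => finrank_eq_add_of_cubic (ρ := σ) (L := [(tricycle 3 4 5, E l)]) hw c2
    (by rw [List.forall_mem_singleton]; exact c23)
  have s1 : ∀ j l, _ := fun j l => finrank_eq_add_of_cubic (ρ := σ)
    (L := [(tricycle 0 1 2, E j), (tricycle 3 4 5, E l)]) hw c1
    (by rw [List.forall_mem_cons, List.forall_mem_singleton]; exact ⟨c12, c13⟩)
  obtain ⟨f1, f2, f3, f4, f5, f6, f7⟩ := eq_of_signedSymm h1 (fun i j l => (h2 i j l).symm) h3
  rw [jointEigenspace_nil, finrank_top] at s3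
  have t : ∀ j l, finrank k (jointEigenspace σ [(tricycle 0 1 2, E j), (tricycle 3 4 5, E l)]) =
    F 0 j l + F 1 j l + F 2 j l := s1
  have u : ∀ l, finrank k (jointEigenspace σ [(tricycle 3 4 5, E l)]) =
    (F 0 0 l + F 1 0 l + F 2 0 l) + (F 0 1 l + F 1 1 l + F 2 1 l) +
      (F 0 2 l + F 1 2 l + F 2 2 l) := fun l => by
    rw [← t, ← t, ← t]; exact s2 l
  have u0 := u 0
  have u1 := u 1
  have u2 := u 2
  have t1 := t 0 1
  have t2 := t 1 1
  simp +decide only [f1, f2, f3, f4, f5, f6, f7] at u0 u1 u2 t1 t2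
  change finrank k (jointEigenspace σ [(tricycle 3 4 5, 1)]) = _ at u0
  change finrank k (jointEigenspace σ [(tricycle 3 4 5, w)]) = _ at u1
  change finrank k (jointEigenspace σ [(tricycle 3 4 5, w ^ 2)]) = _ at u2
  refine ⟨F 0 0 0, F 0 0 1, F 0 1 1, F 1 1 1, ?_, ?_, ?_, ?_, ?_, ?_, rfl⟩
  · omega
  · omega
  · omega
  · omega
  · exact t1.trans (by omega)
  · exact t2.trans (by omega)

end ThreeCycles

section CharTwoInvolution

variable {k V : Type*} [Field k] [CharP k 2] [AddCommGroup V] [Module k V]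
  [FiniteDimensional k V]

theorem apply_eq_self_of_involution {W : Submodule k V} (hW : finrank k W ≤ 1) (f : V →ₗ[k] V)
    (hf : ∀ v ∈ W, f v ∈ W) (hff : ∀ v, f (f v) = v) : ∀ v ∈ W, f v = v := by
  intro v hv
  rcases Nat.le_one_iff_eq_zero_or_eq_one.1 hW with h0 | h1
  · rw [Submodule.finrank_eq_zero] at h0
    subst h0
    rw [(Submodule.mem_bot k).1 hv, map_zero]
  · obtain ⟨r, hr⟩ := exists_smul_of_finrank_eq_one h1 f hf
    by_cases hv0 : v = 0
    · rw [hv0, map_zero]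
    have e := hff v
    rw [hr v hv, map_smul, hr v hv, smul_smul] at e
    have r2 : r * r = 1 := smul_left_injective k hv0 (e.trans (one_smul k v).symm)
    have : (r + 1) ^ 2 = 0 := by
      rw [CharTwo.add_sq, sq, r2, one_pow, CharTwo.add_self_eq_zero]
    have r1 : r = 1 := CharTwo.add_eq_zero.1 (pow_eq_zero_iff two_ne_zero |>.1 this)
    rw [hr v hv, r1, one_smul]

variable {σ : Representation k (alternatingGroup (Fin 10)) V} {w : k}

theorem dswap_apply_of_finrank_eq_two
    (hA : finrank k (jointEigenspace σ [(tricycle 0 1 2, w), (tricycle 3 4 5, w)]) = 2)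
    (hB : finrank k (jointEigenspace σ
      [(tricycle 6 7 8, 1), (tricycle 0 1 2, w), (tricycle 3 4 5, w)]) = 0) {v : V}
    (h1 : σ (tricycle 0 1 2) v = w • v) (h2 : σ (tricycle 3 4 5) v = w • v) :
    σ (dswap 6 7 8 9) v = v := by
  have hrel : (dswap 6 7 8 9 * dswap 6 7 8 9 : alternatingGroup (Fin 10)) = 1 ∧
      (dswap 6 8 7 9 * dswap 6 8 7 9 : alternatingGroup (Fin 10)) = 1 ∧
      (tricycle 0 1 2 * dswap 6 7 8 9 : alternatingGroup (Fin 10)) =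
        dswap 6 7 8 9 * tricycle 0 1 2 ∧
      (tricycle 3 4 5 * dswap 6 7 8 9 : alternatingGroup (Fin 10)) =
        dswap 6 7 8 9 * tricycle 3 4 5 ∧
      (tricycle 0 1 2 * dswap 6 8 7 9 : alternatingGroup (Fin 10)) =
        dswap 6 8 7 9 * tricycle 0 1 2 ∧
      (tricycle 3 4 5 * dswap 6 8 7 9 : alternatingGroup (Fin 10)) =
        dswap 6 8 7 9 * tricycle 3 4 5 ∧
      (dswap 6 7 8 9 * dswap 6 8 7 9 : alternatingGroup (Fin 10)) =
        dswap 6 8 7 9 * dswap 6 7 8 9 := by decide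
  have hrel' : (tricycle 0 1 2 * tricycle 6 7 8 : alternatingGroup (Fin 10)) =
        tricycle 6 7 8 * tricycle 0 1 2 ∧
      (tricycle 3 4 5 * tricycle 6 7 8 : alternatingGroup (Fin 10)) =
        tricycle 6 7 8 * tricycle 3 4 5 ∧
      (dswap 6 7 8 9 * tricycle 6 7 8 : alternatingGroup (Fin 10)) =
        tricycle 6 7 8 * (dswap 6 7 8 9 * dswap 6 8 7 9) ∧
      (tricycle 6 7 8 * (tricycle 6 7 8 * tricycle 6 7 8) : alternatingGroup (Fin 10)) = 1 ∧
      (tricycle 6 7 8 * (dswap 6 7 0 3 * dswap 1 4 2 5 * tricycle 6 7 8) :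
        alternatingGroup (Fin 10)) = dswap 6 7 0 3 * dswap 1 4 2 5 ∧
      (dswap 6 7 0 3 * dswap 1 4 2 5 * (dswap 6 7 0 3 * dswap 1 4 2 5) :
        alternatingGroup (Fin 10)) = 1 ∧
      (tricycle 0 1 2 * (dswap 6 7 0 3 * dswap 1 4 2 5) : alternatingGroup (Fin 10)) =
        dswap 6 7 0 3 * dswap 1 4 2 5 * tricycle 3 4 5 ∧
      (tricycle 3 4 5 * (dswap 6 7 0 3 * dswap 1 4 2 5) : alternatingGroup (Fin 10)) =
        dswap 6 7 0 3 * dswap 1 4 2 5 * tricycle 0 1 2 ∧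
      (dswap 6 7 8 9 * (dswap 6 7 0 3 * dswap 1 4 2 5) : alternatingGroup (Fin 10)) =
        dswap 6 7 0 3 * dswap 1 4 2 5 * dswap 6 7 8 9 := by decide
  set s : alternatingGroup (Fin 10) := dswap 6 7 0 3 * dswap 1 4 2 5
  obtain ⟨hXX, hYY, hAX, hBX, hAY, hBY, hXY⟩ :
      (∀ v, σ (dswap 6 7 8 9) (σ (dswap 6 7 8 9) v) = v) ∧
      (∀ v, σ (dswap 6 8 7 9) (σ (dswap 6 8 7 9) v) = v) ∧
      (∀ v, σ (tricycle 0 1 2) (σ (dswap 6 7 8 9) v) =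
        σ (dswap 6 7 8 9) (σ (tricycle 0 1 2) v)) ∧
      (∀ v, σ (tricycle 3 4 5) (σ (dswap 6 7 8 9) v) =
        σ (dswap 6 7 8 9) (σ (tricycle 3 4 5) v)) ∧
      (∀ v, σ (tricycle 0 1 2) (σ (dswap 6 8 7 9) v) =
        σ (dswap 6 8 7 9) (σ (tricycle 0 1 2) v)) ∧
      (∀ v, σ (tricycle 3 4 5) (σ (dswap 6 8 7 9) v) =
        σ (dswap 6 8 7 9) (σ (tricycle 3 4 5) v)) ∧
      (∀ v, σ (dswap 6 7 8 9) (σ (dswap 6 8 7 9) v) =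
        σ (dswap 6 8 7 9) (σ (dswap 6 7 8 9) v)) := by
    simpa only [DFunLike.ext_iff (F := V →ₗ[k] V), map_mul, map_one, Module.End.mul_apply,
      Module.End.one_apply] using
      And.imp (congrArg σ) (And.imp (congrArg σ) (And.imp (congrArg σ) (And.imp (congrArg σ)
        (And.imp (congrArg σ) (And.imp (congrArg σ) (congrArg σ)))))) hrel
  obtain ⟨hAC, hBC, hXC, hCCC, hCSC, hSS, hAS, hBS, hXS⟩ :
      (∀ v, σ (tricycle 0 1 2) (σ (tricycle 6 7 8) v) =
        σ (tricycle 6 7 8) (σ (tricycle 0 1 2) v)) ∧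
      (∀ v, σ (tricycle 3 4 5) (σ (tricycle 6 7 8) v) =
        σ (tricycle 6 7 8) (σ (tricycle 3 4 5) v)) ∧
      (∀ v, σ (dswap 6 7 8 9) (σ (tricycle 6 7 8) v) =
        σ (tricycle 6 7 8) (σ (dswap 6 7 8 9) (σ (dswap 6 8 7 9) v))) ∧
      (∀ v, σ (tricycle 6 7 8) (σ (tricycle 6 7 8) (σ (tricycle 6 7 8) v)) = v) ∧
      (∀ v, σ (tricycle 6 7 8) (σ s (σ (tricycle 6 7 8) v)) = σ s v) ∧
      (∀ v, σ s (σ s v) = v) ∧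
      (∀ v, σ (tricycle 0 1 2) (σ s v) = σ s (σ (tricycle 3 4 5) v)) ∧
      (∀ v, σ (tricycle 3 4 5) (σ s v) = σ s (σ (tricycle 0 1 2) v)) ∧
      (∀ v, σ (dswap 6 7 8 9) (σ s v) = σ s (σ (dswap 6 7 8 9) v)) := by
    simpa only [DFunLike.ext_iff (F := V →ₗ[k] V), map_mul, map_one, Module.End.mul_apply,
      Module.End.one_apply] using
      And.imp (congrArg σ) (And.imp (congrArg σ) (And.imp (congrArg σ) (And.imp (congrArg σ)
        (And.imp (congrArg σ) (And.imp (congrArg σ) (And.imp (congrArg σ) (And.imp (congrArg σ)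
          (congrArg σ)))))))) hrel'
  by_contra hne
  set W := jointEigenspace σ [(tricycle 0 1 2, w), (tricycle 3 4 5, w)] with hW
  set U := jointEigenspace σ [(dswap 6 7 8 9, 1), (tricycle 0 1 2, w), (tricycle 3 4 5, w)]
    with hU
  have memU : ∀ v, v ∈ U ↔ σ (dswap 6 7 8 9) v = v ∧ σ (tricycle 0 1 2) v = w • v ∧
      σ (tricycle 3 4 5) v = w • v := fun v => by simp [hU]
  have hv : v ∈ W := by simp [hW, h1, h2]
  have hlt : finrank k U < finrank k W := by
    refine Submodule.finrank_lt_finrank_of_lt (lt_of_le_of_ne (fun v hv => ?_) fun h => ?_)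
    · simpa [hW] using ((memU v).1 hv).2
    · exact hne ((memU v).1 (h ▸ hv)).1
  have hmem : v + σ (dswap 6 7 8 9) v ∈ U := by
    rw [memU, map_add, map_add, map_add, hXX, hAX, hBX, h1, h2, map_smul, smul_add]
    exact ⟨add_comm _ _, rfl, rfl⟩
  have hU1 : finrank k U = 1 := by
    have : finrank k U ≠ 0 := fun h => by
      rw [Submodule.finrank_eq_zero] at h
      rw [h, Submodule.mem_bot] at hmem
      have h2 : (2 : k) = 0 := CharTwo.two_eq_zero
      exact hne (by linear_combination (norm := module) hmem - h2 • v)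
    omega
  have hY : ∀ v ∈ U, σ (dswap 6 8 7 9) v = v := by
    refine apply_eq_self_of_involution hU1.le _ (fun v hv => ?_) hYY
    rw [memU] at hv ⊢
    rw [hXY, hAY, hBY, hv.1, hv.2.1, hv.2.2, map_smul]
    exact ⟨rfl, rfl, rfl⟩
  have hC : ∀ v ∈ U, σ (tricycle 6 7 8) v = v := by
    refine apply_eq_self_of_finrank_eq_one hU1 _ (σ s) (fun v hv => ?_) (fun v hv => ?_) hCCC
      hCSC hSS
    · have hyv := hY v hv
      rw [memU] at hv ⊢
      rw [hXC, hAC, hBC, hyv, hv.1, hv.2.1, hv.2.2, map_smul]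
      exact ⟨rfl, rfl, rfl⟩
    · rw [memU] at hv ⊢
      rw [hXS, hAS, hBS, hv.1, hv.2.1, hv.2.2, map_smul]
      exact ⟨rfl, rfl, rfl⟩
  rw [Submodule.finrank_eq_zero] at hB
  obtain ⟨u, hu, hu0⟩ := exists_ne_zero_of_finrank_eq_one hU1
  apply hu0
  rw [← Submodule.mem_bot k, ← hB]
  simp [hC u hu, ((memU u).1 hu).2]

theorem dswap_eq_one_of_finrank_eq_two (hw : w ^ 2 + w + 1 = 0)
    (hA : finrank k (jointEigenspace σ [(tricycle 0 1 2, w), (tricycle 3 4 5, w)]) = 2)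
    (hB : finrank k (jointEigenspace σ
      [(tricycle 6 7 8, 1), (tricycle 0 1 2, w), (tricycle 3 4 5, w)]) = 0)
    (hC : finrank k (jointEigenspace σ [(tricycle 0 1 2, 1), (tricycle 3 4 5, w)]) = 0)
    (hD : finrank k (jointEigenspace σ [(tricycle 3 4 5, 1)]) ≤ 1) :
    σ (dswap 6 7 8 9) = 1 := by
  have hw3 : w ^ 3 = 1 := by linear_combination (w - 1) * hw
  have hrel : (dswap 6 7 8 9 * dswap 6 7 8 9 : alternatingGroup (Fin 10)) = 1 ∧
      (tricycle 3 4 5 * dswap 6 7 8 9 : alternatingGroup (Fin 10)) =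
        dswap 6 7 8 9 * tricycle 3 4 5 ∧
      (tricycle 0 1 2 * tricycle 3 4 5 : alternatingGroup (Fin 10)) =
        tricycle 3 4 5 * tricycle 0 1 2 ∧
      (tricycle 0 1 2 * dswap 0 1 6 7 : alternatingGroup (Fin 10)) =
        dswap 0 1 6 7 * (tricycle 0 1 2 * tricycle 0 1 2) ∧
      (tricycle 3 4 5 * dswap 0 1 6 7 : alternatingGroup (Fin 10)) =
        dswap 0 1 6 7 * tricycle 3 4 5 ∧
      (dswap 6 7 8 9 * dswap 0 1 6 7 : alternatingGroup (Fin 10)) =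
        dswap 0 1 6 7 * dswap 6 7 8 9 ∧
      (tricycle 3 4 5 * dswap 3 4 6 7 : alternatingGroup (Fin 10)) =
        dswap 3 4 6 7 * (tricycle 3 4 5 * tricycle 3 4 5) ∧
      (dswap 6 7 8 9 * dswap 3 4 6 7 : alternatingGroup (Fin 10)) =
        dswap 3 4 6 7 * dswap 6 7 8 9 ∧
      (dswap 0 1 6 7 * dswap 0 1 6 7 : alternatingGroup (Fin 10)) = 1 ∧
      (dswap 3 4 6 7 * dswap 3 4 6 7 : alternatingGroup (Fin 10)) = 1 := by decide
  have hc : (tricycle 0 1 2 ^ 3 : alternatingGroup (Fin 10)) = 1 ∧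
      (tricycle 3 4 5 ^ 3 : alternatingGroup (Fin 10)) = 1 := by decide
  have hAB : Commute (tricycle 0 1 2 : alternatingGroup (Fin 10)) (tricycle 3 4 5) := hrel.2.2.1
  obtain ⟨hXX, hBX, -, hAG, hBG, hXG, hBH, hXH, hGG, hHH⟩ :
      (∀ v, σ (dswap 6 7 8 9) (σ (dswap 6 7 8 9) v) = v) ∧
      (∀ v, σ (tricycle 3 4 5) (σ (dswap 6 7 8 9) v) =
        σ (dswap 6 7 8 9) (σ (tricycle 3 4 5) v)) ∧
      (∀ v, σ (tricycle 0 1 2) (σ (tricycle 3 4 5) v) =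
        σ (tricycle 3 4 5) (σ (tricycle 0 1 2) v)) ∧
      (∀ v, σ (tricycle 0 1 2) (σ (dswap 0 1 6 7) v) =
        σ (dswap 0 1 6 7) (σ (tricycle 0 1 2) (σ (tricycle 0 1 2) v))) ∧
      (∀ v, σ (tricycle 3 4 5) (σ (dswap 0 1 6 7) v) =
        σ (dswap 0 1 6 7) (σ (tricycle 3 4 5) v)) ∧
      (∀ v, σ (dswap 6 7 8 9) (σ (dswap 0 1 6 7) v) =
        σ (dswap 0 1 6 7) (σ (dswap 6 7 8 9) v)) ∧
      (∀ v, σ (tricycle 3 4 5) (σ (dswap 3 4 6 7) v) =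
        σ (dswap 3 4 6 7) (σ (tricycle 3 4 5) (σ (tricycle 3 4 5) v))) ∧
      (∀ v, σ (dswap 6 7 8 9) (σ (dswap 3 4 6 7) v) =
        σ (dswap 3 4 6 7) (σ (dswap 6 7 8 9) v)) ∧
      (∀ v, σ (dswap 0 1 6 7) (σ (dswap 0 1 6 7) v) = v) ∧
      (∀ v, σ (dswap 3 4 6 7) (σ (dswap 3 4 6 7) v) = v) := by
    simpa only [DFunLike.ext_iff (F := V →ₗ[k] V), map_mul, map_one, Module.End.mul_apply,
      Module.End.one_apply] using
      And.imp (congrArg σ) (And.imp (congrArg σ) (And.imp (congrArg σ) (And.imp (congrArg σ)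
        (And.imp (congrArg σ) (And.imp (congrArg σ) (And.imp (congrArg σ) (And.imp (congrArg σ)
          (And.imp (congrArg σ) (congrArg σ))))))))) hrel
  have w4 : w ^ 2 * w ^ 2 = w := by linear_combination w * hw3
  have h11 : ∀ v, σ (tricycle 0 1 2) v = w • v → σ (tricycle 3 4 5) v = w • v →
      σ (dswap 6 7 8 9) v = v := fun v => dswap_apply_of_finrank_eq_two hA hB
  have h21 : ∀ v, σ (tricycle 0 1 2) v = w ^ 2 • v → σ (tricycle 3 4 5) v = w • v →
      σ (dswap 6 7 8 9) v = v := fun v h1 h2 => by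
    have := h11 (σ (dswap 0 1 6 7) v) (by rw [hAG, h1, map_smul, h1, smul_smul, w4, map_smul])
      (by rw [hBG, h2, map_smul])
    rw [hXG] at this
    rw [← hGG (σ (dswap 6 7 8 9) v), this, hGG]
  have h01 : ∀ v, σ (tricycle 0 1 2) v = (1 : k) • v → σ (tricycle 3 4 5) v = w • v →
      σ (dswap 6 7 8 9) v = v := fun v h1 h2 => by
    rw [Submodule.finrank_eq_zero] at hC
    have hv : v ∈ jointEigenspace σ [(tricycle 0 1 2, 1), (tricycle 3 4 5, w)] := by
      simp only [mem_jointEigenspace_cons, h1, h2, mem_jointEigenspace_nil, and_self]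
    rw [hC, Submodule.mem_bot] at hv
    rw [hv, map_zero]
  have hB1 : ∀ v, σ (tricycle 3 4 5) v = w • v → σ (dswap 6 7 8 9) v = v := fun v h2 => by
    have hmem : ∀ {z : k}, z ^ 3 = 1 → σ (tricycle 0 1 2) (cubicPart σ (tricycle 0 1 2) z v) =
        z • cubicPart σ (tricycle 0 1 2) z v ∧ σ (tricycle 3 4 5)
          (cubicPart σ (tricycle 0 1 2) z v) = w • cubicPart σ (tricycle 0 1 2) z v := fun hz => by
      have := cubicPart_mem (ρ := σ) (L := [(tricycle 3 4 5, w)]) hc.1 hz (v := v)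
        (by rw [List.forall_mem_singleton]; exact hAB) (by simp [h2])
      simpa only [mem_jointEigenspace_cons, mem_jointEigenspace_nil, and_true] using this
    rw [eq_sum_cubicPart (ρ := σ) hw (tricycle 0 1 2) v, map_add, map_add]
    rw [h01 _ (hmem (one_pow 3)).1 (hmem (one_pow 3)).2, h11 _ (hmem hw3).1 (hmem hw3).2]
    rw [h21 _ (hmem (z := w ^ 2) (by rw [← pow_mul', pow_mul, hw3, one_pow])).1
      (hmem (z := w ^ 2) (by rw [← pow_mul', pow_mul, hw3, one_pow])).2]
  have hB2 : ∀ v, σ (tricycle 3 4 5) v = w ^ 2 • v → σ (dswap 6 7 8 9) v = v := fun v h => by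
    have := hB1 (σ (dswap 3 4 6 7) v) (by rw [hBH, h, map_smul, h, smul_smul, w4, map_smul])
    rw [hXH] at this
    rw [← hHH (σ (dswap 6 7 8 9) v), this, hHH]
  have hB0 : ∀ v, σ (tricycle 3 4 5) v = (1 : k) • v → σ (dswap 6 7 8 9) v = v := fun v h => by
    refine apply_eq_self_of_involution hD _ (fun v hv => ?_) hXX v (by simpa using h)
    simp only [mem_jointEigenspace_cons, mem_jointEigenspace_nil, and_true, one_smul] at hv ⊢
    rw [hBX, hv]
  refine LinearMap.ext fun v => ?_
  rw [Module.End.one_apply]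
  conv_lhs => rw [eq_sum_cubicPart (ρ := σ) hw (tricycle 3 4 5) v]
  conv_rhs => rw [eq_sum_cubicPart (ρ := σ) hw (tricycle 3 4 5) v]
  rw [map_add, map_add, hB0 _ (apply_cubicPart hc.2 (one_pow 3) v),
    hB1 _ (apply_cubicPart hc.2 hw3 v),
    hB2 _ (apply_cubicPart hc.2 (by rw [← pow_mul', pow_mul, hw3, one_pow]) v)]

end CharTwoInvolution


section

variable {α : Type} [Fintype α] [DecidableEq α]
variable {k : Type v} {V : Type u} [Field k] [CharP k 2] [AddCommGroup V] [Module k V]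
  [FiniteDimensional k V] {ρ : Representation k (alternatingGroup α) V} {w : k}

theorem finrank_threeCycle_eq_one (hw : w ^ 2 + w + 1 = 0) (hcard : 9 ≤ Fintype.card α)
    (hn : finrank k V + 2 ≤ Fintype.card α) (hρ : MovesAll ρ)
    (IH : ∀ m < Fintype.card α, 9 ≤ m → WeakBound.{u, v} k m) {a b c : α}
    (habc : [a, b, c].Nodup) : finrank k (jointEigenspace ρ [(tricycle a b c, w)]) = 1 := by
  obtain ⟨p, hp⟩ : ∃ p : Fin 9 ↪ α, 10 ≤ Fintype.card α →
      ∃ q : Fin 10 ↪ α, p = (Fin.castLEEmb (by decide)).trans q := by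
    by_cases h : 10 ≤ Fintype.card α
    · obtain ⟨q⟩ : Nonempty (Fin 10 ↪ α) := Function.Embedding.nonempty_of_card_le (by simpa)
      exact ⟨_, fun _ => ⟨q, rfl⟩⟩
    · obtain ⟨p⟩ : Nonempty (Fin 9 ↪ α) := Function.Embedding.nonempty_of_card_le (by simpa)
      exact ⟨p, fun h' => absurd h' h⟩
  obtain ⟨g, rfl, rfl, rfl⟩ := exists_alternating_three (by omega)
    (List.Nodup.map (l := [3, 4, 5]) p.injective (by decide)) habc
  have hg := finrank_jointEigenspace_conj (ρ := ρ) (L := [(tricycle (p 3) (p 4) (p 5), w)]) g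
  rw [List.map_singleton, tricycle, conj_dswap] at hg
  refine hg.trans ?_
  clear hg habc g
  obtain ⟨d0, d1, d2, d3, e0, e1, e2, e3, e4, e5, e6⟩ :=
    exists_threeCycle_dims (σ := ρ.comp (altMap p)) hw
  have hcomp : ∀ z : k, jointEigenspace (ρ.comp (altMap p)) [(tricycle 3 4 5, z)] =
      jointEigenspace ρ [(tricycle (p 3) (p 4) (p 5), z)] := fun z => by
    rw [jointEigenspace_comp, List.map_singleton, tricycle, altMap_dswap]
  rw [hcomp] at e1 e2 e3
  have hb : 1 ≤ d1 + 4 * d2 + 4 * d3 := by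
    by_contra! hb
    have htop : jointEigenspace ρ [(tricycle (p 3) (p 4) (p 5), (1 : k))] = ⊤ :=
      Submodule.eq_top_of_finrank_eq (by omega)
    refine hρ.tricycle_ne_one (by omega)
      (List.Nodup.map (l := [3, 4, 5]) p.injective (by decide)) (LinearMap.ext fun v => ?_)
    have : v ∈ jointEigenspace ρ [(tricycle (p 3) (p 4) (p 5), (1 : k))] :=
      htop ▸ Submodule.mem_top
    simpa using this
  change finrank k (jointEigenspace ρ [(tricycle (p 3) (p 4) (p 5), w)]) = 1
  by_cases h12 : 12 ≤ Fintype.card α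
  · have bound : ∀ z : k, (∃ v ∈ jointEigenspace ρ [(tricycle (p 3) (p 4) (p 5), z)],
        ρ (dswap (p 0) (p 1) (p 2) (p 6)) v ≠ v) → Fintype.card α ≤
          finrank k (jointEigenspace ρ [(tricycle (p 3) (p 4) (p 5), z)]) + 5 := by
      rintro z ⟨v, hv, hne⟩
      have hS : ({p 3, p 4, p 5} : Finset α).card = 3 := by
        rw [Finset.card_eq_three]
        exact ⟨_, _, _, p.injective.ne (by decide), p.injective.ne (by decide),
          p.injective.ne (by decide), rfl⟩
      have := card_le_finrank_jointEigenspace (ρ := ρ) {p 3, p 4, p 5}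
        (L := [(tricycle (p 3) (p 4) (p 5), z)]) (fun f hf g hg => by
          rw [List.mem_singleton] at hf
          subst hf
          exact commute_dswap (hg _ (by simp)) (hg _ (by simp)) (hg _ (by simp)) (hg _ (by simp)))
        (List.Nodup.map (l := [0, 1, 2, 6]) p.injective (by decide))
        (by
          intro x hx
          obtain ⟨i, hi, rfl⟩ := List.mem_map.1 (show x ∈ [0, 1, 2, 6].map p from hx)
          simp only [Finset.mem_insert, Finset.mem_singleton, p.injective.eq_iff]
          clear hx
          revert i
          decide) hv hne (m := Fintype.card α - 3) (by omega) (by omega)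
        (IH _ (by omega) (by omega))
      omega
    by_cases h1 : ∃ v ∈ jointEigenspace ρ [(tricycle (p 3) (p 4) (p 5), w)],
        ρ (dswap (p 0) (p 1) (p 2) (p 6)) v ≠ v
    · have := bound _ h1
      omega
    by_cases h2 : ∃ v ∈ jointEigenspace ρ [(tricycle (p 3) (p 4) (p 5), w ^ 2)],
        ρ (dswap (p 0) (p 1) (p 2) (p 6)) v ≠ v
    · have := bound _ h2
      omega
    by_cases h0 : ∃ v ∈ jointEigenspace ρ [(tricycle (p 3) (p 4) (p 5), (1 : k))],
        ρ (dswap (p 0) (p 1) (p 2) (p 6)) v ≠ v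
    · have := bound _ h0
      omega
    exfalso
    push Not at h0 h1 h2
    have hw3 : w ^ 3 = 1 := by linear_combination (w - 1) * hw
    have hc : (tricycle 3 4 5 ^ 3 : alternatingGroup (Fin 9)) = 1 := by decide
    replace hc : tricycle (p 3) (p 4) (p 5) ^ 3 = 1 := by
      have := congrArg (altMap p) hc
      rwa [map_pow, map_one, tricycle, altMap_dswap] at this
    refine hρ (p 0) (p 1) (p 2) (p 6)
      (List.Nodup.map (l := [0, 1, 2, 6]) p.injective (by decide)) (LinearMap.ext fun v => ?_)
    rw [Module.End.one_apply]
    conv_lhs => rw [eq_sum_cubicPart (ρ := ρ) hw (tricycle (p 3) (p 4) (p 5)) v]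
    conv_rhs => rw [eq_sum_cubicPart (ρ := ρ) hw (tricycle (p 3) (p 4) (p 5)) v]
    rw [map_add, map_add, h0 _ (by simp [apply_cubicPart hc (one_pow 3)]),
      h1 _ (by simp [apply_cubicPart hc hw3]),
      h2 _ (by simp [apply_cubicPart hc (show (w ^ 2) ^ 3 = 1 by
        rw [← pow_mul', pow_mul, hw3, one_pow])])]
  by_cases h10 : 10 ≤ Fintype.card α
  swap
  · omega
  obtain rfl | hd3 : d3 = 0 ∨ 1 ≤ d3 := by omega
  · omega
  exfalso
  obtain ⟨q, rfl⟩ := hp h10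
  have h1 : ∀ z : k, jointEigenspace
      (ρ.comp (altMap ((Fin.castLEEmb (by decide : 9 ≤ 10)).trans q))) [(tricycle 3 4 5, z)] =
      jointEigenspace (ρ.comp (altMap q)) [(tricycle 3 4 5, z)] := fun z => by
    ext v
    simp only [mem_jointEigenspace_cons, MonoidHom.comp_apply, tricycle, altMap_dswap,
      mem_jointEigenspace_nil, and_true]
    rfl
  have h2 : ∀ y z : k, jointEigenspace
      (ρ.comp (altMap ((Fin.castLEEmb (by decide : 9 ≤ 10)).trans q)))
        [(tricycle 0 1 2, y), (tricycle 3 4 5, z)] =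
      jointEigenspace (ρ.comp (altMap q)) [(tricycle 0 1 2, y), (tricycle 3 4 5, z)] :=
    fun y z => by
      ext v
      simp only [mem_jointEigenspace_cons, MonoidHom.comp_apply, tricycle, altMap_dswap,
        mem_jointEigenspace_nil, and_true]
      rfl
  have h3 : ∀ x y z : k, jointEigenspace
      (ρ.comp (altMap ((Fin.castLEEmb (by decide : 9 ≤ 10)).trans q)))
        [(tricycle 6 7 8, x), (tricycle 0 1 2, y), (tricycle 3 4 5, z)] =
      jointEigenspace (ρ.comp (altMap q))
        [(tricycle 6 7 8, x), (tricycle 0 1 2, y), (tricycle 3 4 5, z)] := fun x y z => by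
    ext v
    simp only [mem_jointEigenspace_cons, MonoidHom.comp_apply, tricycle, altMap_dswap,
      mem_jointEigenspace_nil, and_true]
    rfl
  rw [← hcomp, h1] at e1
  rw [h2] at e4 e5
  rw [h3] at e6
  refine hρ _ _ _ _ (List.Nodup.map (l := [6, 7, 8, 9]) q.injective (by decide)) ?_
  rw [← altMap_dswap]
  exact dswap_eq_one_of_finrank_eq_two (σ := ρ.comp (altMap q)) hw
    (e5.trans (by omega)) (e6.trans (by omega)) (e4.trans (by omega)) (e1.trans_le (by omega))

end

section CharTwoStandard

variable {k V : Type*} [Field k] [CharP k 2] [AddCommGroup V] [Module k V] {w : k}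

theorem tricycle_apply_of_sum_eq_zero {σ : Representation k (alternatingGroup (Fin 8)) V}
    (hw : w ^ 2 + w + 1 = 0) (hl : finrank k (jointEigenspace σ [(tricycle 0 1 2, w)]) = 1) {v : V}
    (hv : v + σ (tricycle 0 1 2) v + σ (tricycle 0 1 2) (σ (tricycle 0 1 2) v) = 0) :
    σ (tricycle 3 4 5) v = v := by
  have hw3 : w ^ 3 = 1 := by linear_combination (w - 1) * hw
  have w4 : w ^ 2 * w ^ 2 = w := by linear_combination w * hw3
  have hc : (tricycle 0 1 2 ^ 3 : alternatingGroup (Fin 8)) = 1 := by decide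
  have hrel : (tricycle 0 1 2 * tricycle 3 4 5 : alternatingGroup (Fin 8)) =
      tricycle 3 4 5 * tricycle 0 1 2 ∧
      (tricycle 0 1 2 * dswap 3 4 6 7 : alternatingGroup (Fin 8)) = dswap 3 4 6 7 * tricycle 0 1 2 ∧
      (tricycle 3 4 5 * (dswap 3 4 6 7 * tricycle 3 4 5) : alternatingGroup (Fin 8)) =
        dswap 3 4 6 7 ∧
      (tricycle 3 4 5 * (tricycle 3 4 5 * tricycle 3 4 5) : alternatingGroup (Fin 8)) = 1 ∧
      (dswap 3 4 6 7 * dswap 3 4 6 7 : alternatingGroup (Fin 8)) = 1 ∧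
      (tricycle 0 1 2 * dswap 0 1 6 7 : alternatingGroup (Fin 8)) =
        dswap 0 1 6 7 * (tricycle 0 1 2 * tricycle 0 1 2) ∧
      (tricycle 3 4 5 * dswap 0 1 6 7 : alternatingGroup (Fin 8)) = dswap 0 1 6 7 * tricycle 3 4 5 ∧
      (dswap 0 1 6 7 * dswap 0 1 6 7 : alternatingGroup (Fin 8)) = 1 := by decide
  obtain ⟨hAC, hAT, hCTC, hCCC, hTT, hAR, hCR, hRR⟩ :
      (∀ v, σ (tricycle 0 1 2) (σ (tricycle 3 4 5) v) = σ (tricycle 3 4 5) (σ (tricycle 0 1 2) v)) ∧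
      (∀ v, σ (tricycle 0 1 2) (σ (dswap 3 4 6 7) v) = σ (dswap 3 4 6 7) (σ (tricycle 0 1 2) v)) ∧
      (∀ v, σ (tricycle 3 4 5) (σ (dswap 3 4 6 7) (σ (tricycle 3 4 5) v)) = σ (dswap 3 4 6 7) v) ∧
      (∀ v, σ (tricycle 3 4 5) (σ (tricycle 3 4 5) (σ (tricycle 3 4 5) v)) = v) ∧
      (∀ v, σ (dswap 3 4 6 7) (σ (dswap 3 4 6 7) v) = v) ∧
      (∀ v, σ (tricycle 0 1 2) (σ (dswap 0 1 6 7) v) = σ (dswap 0 1 6 7) (σ (tricycle 0 1 2)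
        (σ (tricycle 0 1 2) v))) ∧
      (∀ v, σ (tricycle 3 4 5) (σ (dswap 0 1 6 7) v) = σ (dswap 0 1 6 7) (σ (tricycle 3 4 5) v)) ∧
      (∀ v, σ (dswap 0 1 6 7) (σ (dswap 0 1 6 7) v) = v) := by
    simpa only [DFunLike.ext_iff (F := V →ₗ[k] V), map_mul, map_one, Module.End.mul_apply,
      Module.End.one_apply] using
      (And.imp (congrArg σ) (And.imp (congrArg σ) (And.imp (congrArg σ) (And.imp (congrArg σ)
        (And.imp (congrArg σ) (And.imp (congrArg σ) (And.imp (congrArg σ) (congrArg σ)))))))) hrel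
  have mem : ∀ v, v ∈ jointEigenspace σ [(tricycle 0 1 2, w)] ↔ σ (tricycle 0 1 2) v = w • v :=
    fun v => by simp
  have hB1 : ∀ v, σ (tricycle 0 1 2) v = w • v → σ (tricycle 3 4 5) v = v := fun v hv => by
    refine apply_eq_self_of_finrank_eq_one hl _ (σ (dswap 3 4 6 7)) (fun v hv => ?_)
      (fun v hv => ?_) hCCC hCTC hTT v ((mem v).2 hv)
    · rw [mem] at hv ⊢
      rw [hAC, hv, map_smul]
    · rw [mem] at hv ⊢
      rw [hAT, hv, map_smul]
  have hB2 : ∀ v, σ (tricycle 0 1 2) v = w ^ 2 • v → σ (tricycle 3 4 5) v = v := fun v h => by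
    have := hB1 (σ (dswap 0 1 6 7) v) (by rw [hAR, h, map_smul, h, smul_smul, w4, map_smul])
    rw [hCR] at this
    rw [← hRR (σ (tricycle 3 4 5) v), this, hRR]
  have h0 : cubicPart σ (tricycle 0 1 2) 1 v = 0 := by
    rw [cubicPart_apply, one_pow, one_smul, one_smul, hv]
  have e := eq_sum_cubicPart (ρ := σ) hw (tricycle 0 1 2) v
  rw [h0, zero_add] at e
  conv_lhs => rw [e]
  conv_rhs => rw [e]
  rw [map_add, hB1 _ (apply_cubicPart hc hw3 v),
    hB2 _ (apply_cubicPart hc (by rw [← pow_mul', pow_mul, hw3, one_pow]) v)]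

variable {σ : Representation k (alternatingGroup (Fin 9)) V}

theorem eq_zero_of_apply_eq_smul {f : V →ₗ[k] V} (hw : w ^ 2 + w + 1 = 0) {v : V}
    (h1 : f v = w • v) (h2 : f v = w ^ 2 • v) : v = 0 := by
  have h : (1 : k) • v = 0 := by
    linear_combination (norm := module) h2 - h1 + hw • v -
      (CharTwo.two_eq_zero : (2 : k) = 0) • (w • v)
  rwa [one_smul] at h

theorem exists_smul_of_sum_eq_zero
    (hw : w ^ 2 + w + 1 = 0) (hl : finrank k (jointEigenspace σ [(tricycle 0 1 2, w)]) = 1)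
      {u v : V}
    (hu0 : u ≠ 0)
    (hu : u + σ (tricycle 0 1 2) u + σ (tricycle 0 1 2) (σ (tricycle 0 1 2) u) = 0)
    (hv : v + σ (tricycle 0 1 2) v + σ (tricycle 0 1 2) (σ (tricycle 0 1 2) v) = 0)
    (hu' : σ (dswap 0 1 6 7) u = u) (hv' : σ (dswap 0 1 6 7) v = v) : ∃ r : k, v = r • u := by
  have hw3 : w ^ 3 = 1 := by linear_combination (w - 1) * hw
  have w4 : w ^ 2 * w ^ 2 = w := by linear_combination w * hw3
  have hc : (tricycle 0 1 2 ^ 3 : alternatingGroup (Fin 9)) = 1 := by decide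
  have hrel : (tricycle 0 1 2 * dswap 0 1 6 7 : alternatingGroup (Fin 9)) =
      dswap 0 1 6 7 * (tricycle 0 1 2 * tricycle 0 1 2) ∧
      (dswap 0 1 6 7 * dswap 0 1 6 7 : alternatingGroup (Fin 9)) = 1 := by decide
  obtain ⟨hAR, hRR⟩ :
      (∀ v, σ (tricycle 0 1 2) (σ (dswap 0 1 6 7) v) = σ (dswap 0 1 6 7) (σ (tricycle 0 1 2)
        (σ (tricycle 0 1 2) v))) ∧
      (∀ v, σ (dswap 0 1 6 7) (σ (dswap 0 1 6 7) v) = v) := by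
    simpa only [DFunLike.ext_iff (F := V →ₗ[k] V), map_mul, map_one, Module.End.mul_apply,
      Module.End.one_apply] using
      (And.imp (congrArg σ) (congrArg σ)) hrel
  have inj : ∀ x, x + σ (tricycle 0 1 2) x + σ (tricycle 0 1 2) (σ (tricycle 0 1 2) x) = 0 →
      σ (dswap 0 1 6 7) x = x → cubicPart σ (tricycle 0 1 2) w x = 0 → x = 0 := by
    intro x hx hx' h
    have h0 : cubicPart σ (tricycle 0 1 2) 1 x = 0 := by
      rw [cubicPart_apply, one_pow, one_smul, one_smul, hx]
    have e := eq_sum_cubicPart (ρ := σ) hw (tricycle 0 1 2) x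
    have h2 := apply_cubicPart (ρ := σ) hc (w := w ^ 2)
      (by rw [← pow_mul', pow_mul, hw3, one_pow]) x
    rw [h0, h, zero_add, zero_add] at e
    rw [← e] at h2
    refine eq_zero_of_apply_eq_smul hw ?_ h2
    have := hAR x
    rw [hx', h2, map_smul, h2, smul_smul, w4, map_smul, hx'] at this
    rw [h2, this]
  have hpu : cubicPart σ (tricycle 0 1 2) w u ≠ 0 := fun h => hu0 (inj u hu hu' h)
  have mem : ∀ x, cubicPart σ (tricycle 0 1 2) w x ∈ jointEigenspace σ [(tricycle 0 1 2, w)] :=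
    fun x => by simp [apply_cubicPart hc hw3]
  obtain ⟨r, hr⟩ := (finrank_eq_one_iff_of_nonzero' (⟨_, mem u⟩ :
    jointEigenspace σ [(tricycle 0 1 2, w)]) (by simpa [Subtype.ext_iff] using hpu)).1 hl ⟨_, mem v⟩
  replace hr : r • cubicPart σ (tricycle 0 1 2) w u = cubicPart σ (tricycle 0 1 2) w v :=
    congrArg Subtype.val hr
  refine ⟨r, sub_eq_zero.1 (inj _ ?_ ?_ ?_)⟩
  · simp only [map_sub, map_smul]
    linear_combination (norm := module) hv - r • hu
  · rw [map_sub, map_smul, hu', hv']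
  · rw [map_sub, map_smul, hr, sub_self]

theorem exists_sum_eq_zero
    (hw : w ^ 2 + w + 1 = 0) (hl : finrank k (jointEigenspace σ [(tricycle 0 1 2, w)]) = 1) :
    ∃ u ≠ 0, u + σ (tricycle 0 1 2) u + σ (tricycle 0 1 2) (σ (tricycle 0 1 2) u) = 0 ∧
      σ (dswap 0 1 3 4) u = u := by
  have hw3 : w ^ 3 = 1 := by linear_combination (w - 1) * hw
  have hrel : (tricycle 0 1 2 * dswap 0 1 3 4 : alternatingGroup (Fin 9)) =
      dswap 0 1 3 4 * (tricycle 0 1 2 * tricycle 0 1 2) ∧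
      (dswap 0 1 3 4 * dswap 0 1 3 4 : alternatingGroup (Fin 9)) = 1 := by decide
  obtain ⟨hAR, hRR⟩ :
      (∀ v, σ (tricycle 0 1 2) (σ (dswap 0 1 3 4) v) = σ (dswap 0 1 3 4) (σ (tricycle 0 1 2)
        (σ (tricycle 0 1 2) v))) ∧
      (∀ v, σ (dswap 0 1 3 4) (σ (dswap 0 1 3 4) v) = v) := by
    simpa only [DFunLike.ext_iff (F := V →ₗ[k] V), map_mul, map_one, Module.End.mul_apply,
      Module.End.one_apply] using
      (And.imp (congrArg σ) (congrArg σ)) hrel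
  obtain ⟨u, hu, hu0⟩ := exists_ne_zero_of_finrank_eq_one hl
  replace hu : σ (tricycle 0 1 2) u = w • u := by simpa using hu
  have hru : σ (tricycle 0 1 2) (σ (dswap 0 1 3 4) u) = w ^ 2 • σ (dswap 0 1 3 4) u := by
    rw [hAR, hu, map_smul, hu, smul_smul, map_smul, sq]
  refine ⟨u + σ (dswap 0 1 3 4) u, fun h => hu0 ?_, ?_, ?_⟩
  · have e : σ (dswap 0 1 3 4) u = u := by
      linear_combination (norm := module) h - (CharTwo.two_eq_zero : (2 : k) = 0) • u
    rw [e] at hru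
    exact eq_zero_of_apply_eq_smul hw hu hru
  · simp only [map_add, map_smul, hu, hru]
    linear_combination (norm := module) hw • u + hw • σ (dswap 0 1 3 4) u +
      (w * (w - 1) * hw) • σ (dswap 0 1 3 4) u
  · rw [map_add, hRR, add_comm]

theorem tricycle_apply_or_of_sum_eq_zero
    (hw : w ^ 2 + w + 1 = 0) (hl : finrank k (jointEigenspace σ [(tricycle 0 1 2, w)]) = 1)
    (hfix : ∀ v, v + σ (tricycle 0 3 1) v + σ (tricycle 0 3 1) (σ (tricycle 0 3 1) v) = 0 →
      σ (tricycle 2 4 5) v = v) {v : V}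
    (hv : v + σ (tricycle 0 1 2) v + σ (tricycle 0 1 2) (σ (tricycle 0 1 2) v) = 0)
    (h354 : σ (tricycle 3 5 4) v = v) (h34 : σ (dswap 0 1 3 4) v = v)
    (h67 : σ (dswap 0 1 6 7) v = v) :
    σ (tricycle 4 3 2) v = v ∨ σ (tricycle 4 5 2) v = v := by
  rw [show (tricycle 4 3 2 : alternatingGroup (Fin 9)) = tricycle 2 4 3 by decide,
    show (tricycle 4 5 2 : alternatingGroup (Fin 9)) = tricycle 2 4 5 by decide]
  have h2 : (2 : k) = 0 := CharTwo.two_eq_zero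
  have hrel : (tricycle 2 4 3 : alternatingGroup (Fin 9)) = tricycle 2 5 3 * tricycle 3 5 4 ∧
      (tricycle 2 4 3 * (tricycle 2 4 3 * tricycle 2 4 3) : alternatingGroup (Fin 9)) = 1 ∧
      (tricycle 2 5 3 * (tricycle 2 5 3 * tricycle 2 5 3) : alternatingGroup (Fin 9)) = 1 ∧
      (tricycle 0 1 2 * (tricycle 0 1 2 * (tricycle 0 2 4 * tricycle 1 3 5))
        : alternatingGroup (Fin 9)) = tricycle 0 2 4 * (tricycle 1 3 5 * tricycle 2 4 3) ∧
      (tricycle 0 1 2 * (tricycle 0 2 4 * tricycle 1 3 5) : alternatingGroup (Fin 9)) =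
        tricycle 0 2 4 * (tricycle 1 3 5 * (tricycle 2 4 3 * tricycle 2 4 3)) ∧
      (tricycle 0 3 1 * (tricycle 0 2 4 * tricycle 1 3 5) : alternatingGroup (Fin 9)) =
        tricycle 0 2 4 * (tricycle 1 3 5 * tricycle 2 5 3) ∧
      (dswap 0 1 6 7 * (tricycle 0 2 4 * tricycle 1 3 5) : alternatingGroup (Fin 9)) =
        tricycle 0 2 4 * (tricycle 1 3 5 * dswap 2 3 6 7) ∧
      (dswap 2 3 6 7 * tricycle 2 4 3 : alternatingGroup (Fin 9)) = dswap 0 1 3 4 * dswap 0 1 6 7 ∧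
      (dswap 2 3 6 7 * dswap 2 3 6 7 : alternatingGroup (Fin 9)) = 1 := by decide
  obtain ⟨h45, h4, h5, hA4, hA4b, hD5, hRQ, hQ4, hQQ⟩ :
      (∀ v, σ (tricycle 2 4 3) v = σ (tricycle 2 5 3) (σ (tricycle 3 5 4) v)) ∧
      (∀ v, σ (tricycle 2 4 3) (σ (tricycle 2 4 3) (σ (tricycle 2 4 3) v)) = v) ∧
      (∀ v, σ (tricycle 2 5 3) (σ (tricycle 2 5 3) (σ (tricycle 2 5 3) v)) = v) ∧
      (∀ v, σ (tricycle 0 1 2) (σ (tricycle 0 1 2) (σ (tricycle 0 2 4) (σ (tricycle 1 3 5) v))) =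
        σ (tricycle 0 2 4) (σ (tricycle 1 3 5) (σ (tricycle 2 4 3) v))) ∧
      (∀ v, σ (tricycle 0 1 2) (σ (tricycle 0 2 4) (σ (tricycle 1 3 5) v)) = σ (tricycle 0 2 4)
        (σ (tricycle 1 3 5) (σ (tricycle 2 4 3) (σ (tricycle 2 4 3) v)))) ∧
      (∀ v, σ (tricycle 0 3 1) (σ (tricycle 0 2 4) (σ (tricycle 1 3 5) v)) = σ (tricycle 0 2 4)
        (σ (tricycle 1 3 5) (σ (tricycle 2 5 3) v))) ∧
      (∀ v, σ (dswap 0 1 6 7) (σ (tricycle 0 2 4) (σ (tricycle 1 3 5) v)) = σ (tricycle 0 2 4)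
        (σ (tricycle 1 3 5) (σ (dswap 2 3 6 7) v))) ∧
      (∀ v, σ (dswap 2 3 6 7) (σ (tricycle 2 4 3) v) = σ (dswap 0 1 3 4) (σ (dswap 0 1 6 7) v)) ∧
      (∀ v, σ (dswap 2 3 6 7) (σ (dswap 2 3 6 7) v) = v) := by
    simpa only [DFunLike.ext_iff (F := V →ₗ[k] V), map_mul, map_one, Module.End.mul_apply,
      Module.End.one_apply] using
      (And.imp (congrArg σ) (And.imp (congrArg σ) (And.imp (congrArg σ) (And.imp (congrArg σ)
        (And.imp (congrArg σ) (And.imp (congrArg σ) (And.imp (congrArg σ) (And.imp (congrArg σ)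
          (congrArg σ))))))))) hrel
  have e45 : σ (tricycle 2 4 3) v = σ (tricycle 2 5 3) v := by rw [h45, h354]
  have eQ : σ (dswap 2 3 6 7) (σ (tricycle 2 4 3) v) = v := by rw [hQ4, h67, h34]
  set δ := σ (tricycle 2 4 3) v + v with hδ
  have hQδ : σ (dswap 2 3 6 7) δ = δ := by
    rw [hδ, map_add, eQ]
    conv_lhs => rw [← eQ, hQQ, eQ]
    rw [add_comm]
  have h4δ : δ + σ (tricycle 2 4 3) δ + σ (tricycle 2 4 3) (σ (tricycle 2 4 3) δ) = 0 := by
    simp only [hδ, map_add, h4]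
    linear_combination (norm := module) h2 • (v + σ (tricycle 2 4 3) v +
      σ (tricycle 2 4 3) (σ (tricycle 2 4 3) v))
  have h5δ : δ + σ (tricycle 2 5 3) δ + σ (tricycle 2 5 3) (σ (tricycle 2 5 3) δ) = 0 := by
    simp only [hδ, e45, map_add, h5]
    linear_combination (norm := module) h2 • (v + σ (tricycle 2 5 3) v +
      σ (tricycle 2 5 3) (σ (tricycle 2 5 3) v))
  by_cases hδ0 : δ = 0
  · left
    linear_combination (norm := module) hδ0 - h2 • v
  right
  have hinj : ∀ g x, σ g x = 0 → x = 0 := fun g x h => by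
    rw [← apply_inv_apply (ρ := σ) g x, h, map_zero]
  set u := σ (tricycle 0 2 4) (σ (tricycle 1 3 5) δ) with hu
  have hu0 : u ≠ 0 := fun h => hδ0 (hinj _ _ (hinj _ _ h))
  obtain ⟨r, hr⟩ := exists_smul_of_sum_eq_zero hw hl hu0
    (by
      rw [hu, hA4, hA4b, add_right_comm, ← map_add, ← map_add, ← map_add, ← map_add, h4δ,
        map_zero, map_zero]) hv (by rw [hu, hRQ, hQδ]) h67
  have hD : u + σ (tricycle 0 3 1) u + σ (tricycle 0 3 1) (σ (tricycle 0 3 1) u) = 0 := by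
    rw [hu, hD5, hD5, ← map_add, ← map_add, ← map_add, ← map_add, h5δ, map_zero, map_zero]
  rw [hr, map_smul, hfix u hD]

end CharTwoStandard

theorem rel_of_forall_right {α : Type*} {P : α → Prop} {N : α → α → Prop}
    (hsymm : ∀ x y, N x y → N y x)
    (hN : ∀ x y z, P x → P y → P z → x ≠ y → x ≠ z → y ≠ z → N x y → N x z)
    {a b : α} (hab : a ≠ b) (ha : P a) (hb : P b) (h : N a b) {x y : α} (hx : P x) (hy : P y)
    (hxy : x ≠ y) : N x y := by
  have key : ∀ z, P z → a ≠ z → N a z := fun z hz haz => by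
    by_cases hbz : b = z
    · exact hbz ▸ h
    · exact hN a b z ha hb hz hab haz hbz h
  by_cases hxa : a = x
  · exact hxa ▸ key y hy (by rwa [hxa])
  by_cases hya : a = y
  · exact hya ▸ hsymm _ _ (key x hx (by rw [hya]; exact hxy.symm))
  · exact hN x a y hx ha hy (Ne.symm hxa) hxy hya (hsymm _ _ (key x hx hxa))

section

variable {α : Type} [Fintype α] [DecidableEq α]
variable {k V : Type*} [Field k] [CharP k 2] [AddCommGroup V] [Module k V]
  {ρ : Representation k (alternatingGroup α) V} {w : k}

omit [DecidableEq α] in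
theorem exists_notMem_list (l : List α) (h : l.length < Fintype.card α) : ∃ x, x ∉ l := by
  classical
  by_contra! hl
  have : l.toFinset = Finset.univ := Finset.eq_univ_iff_forall.2 fun x => by simpa using hl x
  have := l.toFinset_card_le
  simp_all
  omega

theorem exists_isStandardVector_of_charTwo (hw : w ^ 2 + w + 1 = 0) (hcard : 9 ≤ Fintype.card α)
    (hline : ∀ a b c : α, [a, b, c].Nodup →
      finrank k (jointEigenspace ρ [(tricycle a b c, w)]) = 1) :
    ∃ a b c v, [a, b, c].Nodup ∧ IsStandardVector ρ a b c v := by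
  have hline' : ∀ {n : ℕ} (p : Fin (n + 3) ↪ α),
      finrank k (jointEigenspace (ρ.comp (altMap p)) [(tricycle 0 1 2, w)]) = 1 := fun {n} p => by
    rw [jointEigenspace_comp, List.map_singleton, tricycle, altMap_dswap]
    refine hline _ _ _ (List.Nodup.map (l := [0, 1, 2]) p.injective ?_)
    simp [Fin.ext_iff, Nat.mod_eq_of_lt]
  have hfix : ∀ {a b c x y z : α}, [a, b, c, x, y, z].Nodup → ∀ v,
      v + ρ (tricycle a b c) v + ρ (tricycle a b c) (ρ (tricycle a b c) v) = 0 →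
      ρ (tricycle x y z) v = v := by
    intro a b c x y z hd v hv
    obtain ⟨s, hs⟩ := exists_notMem_list [a, b, c, x, y, z] (by simp; omega)
    obtain ⟨t, ht⟩ := exists_notMem_list [a, b, c, x, y, z, s] (by simp; omega)
    have hd' : [a, b, c, x, y, z, s, t].Nodup := by
      simp only [List.nodup_cons, List.mem_cons, List.not_mem_nil, or_false, not_or,
        List.nodup_nil, and_true, not_false_eq_true] at *
      grind
    have := tricycle_apply_of_sum_eq_zero (σ := ρ.comp (altMap ⟨_, hd'.injective_get⟩)) hw
      (hline' (n := 5) _) (v := v)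
    simp only [MonoidHom.comp_apply, tricycle, altMap_dswap] at this
    exact this hv
  obtain ⟨p⟩ : Nonempty (Fin 9 ↪ α) := Function.Embedding.nonempty_of_card_le (by simpa)
  have hp : ∀ i : Fin 9, i ≠ 0 → i ≠ 1 → i ≠ 2 → p i ≠ p 0 ∧ p i ≠ p 1 ∧ p i ≠ p 2 :=
    fun i h0 h1 h2 => ⟨p.injective.ne h0, p.injective.ne h1, p.injective.ne h2⟩
  obtain ⟨v, hv0, hv, h34⟩ := exists_sum_eq_zero (σ := ρ.comp (altMap p)) hw (hline' (n := 6) p)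
  have hor := tricycle_apply_or_of_sum_eq_zero (σ := ρ.comp (altMap p)) hw (hline' (n := 6) p)
    (fun v hv => by
      simp only [MonoidHom.comp_apply, tricycle, altMap_dswap] at hv ⊢
      exact hfix (List.Nodup.map (l := [0, 3, 1, 2, 4, 5]) p.injective (by decide)) v hv) hv
  simp only [MonoidHom.comp_apply, tricycle, altMap_dswap] at hv h34 hor
  have h01 : p 0 ≠ p 1 := p.injective.ne (by decide)
  have h02 : p 0 ≠ p 2 := p.injective.ne (by decide)
  have h12 : p 1 ≠ p 2 := p.injective.ne (by decide)
  have hcyc : ∀ x y z, x ≠ p 0 ∧ x ≠ p 1 ∧ x ≠ p 2 → y ≠ p 0 ∧ y ≠ p 1 ∧ y ≠ p 2 →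
      z ≠ p 0 ∧ z ≠ p 1 ∧ z ≠ p 2 → x ≠ y → x ≠ z → y ≠ z → ρ (tricycle x y z) v = v := by
    intro x y z hx hy hz hxy hxz hyz
    refine hfix (a := p 0) (b := p 1) (c := p 2) ?_ v hv
    simp only [List.nodup_cons, List.mem_cons, List.not_mem_nil, or_false, not_or,
      List.nodup_nil, and_true, not_false_eq_true]
    grind
  have hsymm : ∀ x y, ρ (dswap (p 0) (p 1) x y) v = v → ρ (dswap (p 0) (p 1) y x) v = v := by
    intro x y h
    rw [← h]
    congr 2
    simp only [dswap, swap_comm y x, eq_comm (a := y) (b := x)]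
  have hN : ∀ x y, x ≠ p 0 ∧ x ≠ p 1 ∧ x ≠ p 2 → y ≠ p 0 ∧ y ≠ p 1 ∧ y ≠ p 2 → x ≠ y →
      ρ (dswap (p 0) (p 1) x y) v = v := fun x y hx hy hxy =>
    rel_of_forall_right (P := fun x => x ≠ p 0 ∧ x ≠ p 1 ∧ x ≠ p 2)
      (N := fun x y => ρ (dswap (p 0) (p 1) x y) v = v) hsymm
      (fun x y z hx hy hz hxy hxz hyz h => by
        have := hcyc x y z hx hy hz hxy hxz hyz
        exact apply_neg_of_conj hx.1.symm hx.2.1.symm hy.1.symm hy.2.1.symm hz.1.symm hz.2.1.symm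
          hxy hxz hyz h this this)
      (p.injective.ne (by decide : (3 : Fin 9) ≠ 4)) (hp 3 (by decide) (by decide) (by decide))
      (hp 4 (by decide) (by decide) (by decide)) h34 hx hy hxy
  obtain ⟨x, y, hx, hy, hxy, h⟩ : ∃ x y, (x ≠ p 0 ∧ x ≠ p 1 ∧ x ≠ p 2) ∧
      (y ≠ p 0 ∧ y ≠ p 1 ∧ y ≠ p 2) ∧ x ≠ y ∧ ρ (tricycle x y (p 2)) v = v := by
    rcases hor (hcyc _ _ _ (hp 3 (by decide) (by decide) (by decide))
      (hp 5 (by decide) (by decide) (by decide)) (hp 4 (by decide) (by decide) (by decide))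
      (p.injective.ne (by decide)) (p.injective.ne (by decide)) (p.injective.ne (by decide))) h34
      (hN _ _ (hp 6 (by decide) (by decide) (by decide)) (hp 7 (by decide) (by decide) (by decide))
        (p.injective.ne (by decide))) with h | h
    · exact ⟨_, _, hp 4 (by decide) (by decide) (by decide),
        hp 3 (by decide) (by decide) (by decide), p.injective.ne (by decide), h⟩
    · exact ⟨_, _, hp 4 (by decide) (by decide) (by decide),
        hp 5 (by decide) (by decide) (by decide), p.injective.ne (by decide), h⟩
  have hx2 : ρ (dswap (p 0) (p 1) x (p 2)) v = v :=
    apply_neg_of_conj hx.1.symm hx.2.1.symm hy.1.symm hy.2.1.symm h02 h12 hxy hx.2.2 hy.2.2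
      (hN x y hx hy hxy) h h
  have hz2 : ∀ z, z ≠ p 0 ∧ z ≠ p 1 ∧ z ≠ p 2 → ρ (dswap (p 0) (p 1) (p 2) z) v = v := by
    intro z hz
    by_cases hxz : x = z
    · exact hsymm _ _ (hxz ▸ hx2)
    obtain ⟨t, ht⟩ := exists_notMem_list [p 0, p 1, p 2, x, z] (by simp; omega)
    simp only [List.mem_cons, List.not_mem_nil, or_false, not_or] at ht
    obtain ⟨t0, t1, t2, tx, tz⟩ := ht
    have hc := hcyc x t z hx ⟨t0, t1, t2⟩ hz (Ne.symm tx) hxz tz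
    have h1 := conj_dswap (tricycle x t z) (p 0) (p 1) (p 2) x
    rw [dswap_apply_of_ne hx.1.symm (Ne.symm t0) hx.1.symm hz.1.symm,
      dswap_apply_of_ne hx.2.1.symm (Ne.symm t1) hx.2.1.symm hz.2.1.symm,
      dswap_apply_of_ne hx.2.2.symm (Ne.symm t2) hx.2.2.symm hz.2.2.symm,
      show (tricycle x t z : Perm α) x = z by
        simp [coe_dswap (Ne.symm tx) hxz, swap_apply_of_ne_of_ne (Ne.symm hxz) (Ne.symm tz)]] at h1
    have h4 := apply_apply_of_mul_eq (ρ := ρ) (mul_inv_eq_iff_eq_mul.1 h1).symm v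
    rw [hc, hsymm _ _ hx2, hc] at h4
    exact h4
  refine ⟨p 0, p 1, p 2, v, List.Nodup.map (l := [0, 1, 2]) p.injective (by decide), hv0,
    fun x y hxy h1 h2 h3 h4 => ?_, hv⟩
  rw [neg_eq_of_add_eq_zero_left (b := v) (a := v)
    (by linear_combination (norm := module) (CharTwo.two_eq_zero : (2 : k) = 0) • v)]
  by_cases hx2 : x = p 2
  · subst hx2
    exact hz2 y ⟨h3, h4, hxy.symm⟩
  by_cases hy2 : y = p 2
  · subst hy2
    exact hsymm _ _ (hz2 x ⟨h1, h2, hxy⟩)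
  · exact hN x y ⟨h1, h2, hx2⟩ ⟨h3, h4, hy2⟩ hxy

end

section

variable {α : Type} [Fintype α] [DecidableEq α]
variable {k : Type v} {V : Type u} [Field k] [AddCommGroup V] [Module k V]
  [FiniteDimensional k V] {ρ : Representation k (alternatingGroup α) V}

/-- The bounds for all degrees at least `N` follow from the existence of standard vectors in
representations violating the stronger bound. -/
theorem le_finrank_of_exists_isStandardVector {N : ℕ} (hN : 6 ≤ N)
    (hstd : ∀ (α : Type) [Fintype α] [DecidableEq α] (V : Type u) [AddCommGroup V] [Module k V]
      [FiniteDimensional k V] (ρ : Representation k (alternatingGroup α) V),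
      N ≤ Fintype.card α → finrank k V + 2 ≤ Fintype.card α → MovesAll ρ →
      (∀ m < Fintype.card α, N ≤ m → WeakBound.{u, v} k m) →
      ∃ a b c w, [a, b, c].Nodup ∧ IsStandardVector ρ a b c w)
    (hcard : N ≤ Fintype.card α) (hρ : MovesAll ρ) :
    Fintype.card α ≤ finrank k V + 2 ∧
      ((Fintype.card α : k) ≠ 0 → Fintype.card α ≤ finrank k V + 1) := by
  have weak : ∀ m, N ≤ m → WeakBound.{u, v} k m := fun m => by
    induction m using Nat.strong_induction_on with
    | _ m ih =>
      intro hm α _ _ V _ _ _ ρ hc hρ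
      subst hc
      by_contra! hlt
      obtain ⟨a, b, c, w, habc, hw⟩ := hstd α V ρ hm (by omega) hρ ih
      have := (hw.le_finrank habc (by omega)).1
      omega
  by_cases hn : finrank k V + 2 ≤ Fintype.card α
  · obtain ⟨a, b, c, w, habc, hw⟩ := hstd α V ρ hcard hn hρ fun m _ => weak m
    exact hw.le_finrank habc (by omega)
  · exact ⟨by omega, fun _ => by omega⟩

theorem MovesAll.le_finrank [IsAlgClosed k] (hρ : MovesAll ρ)
    (hcard : 9 ≤ Fintype.card α ∨ (2 : k) ≠ 0 ∧ 7 ≤ Fintype.card α) :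
    Fintype.card α ≤ finrank k V + 2 ∧
      ((Fintype.card α : k) ≠ 0 → Fintype.card α ≤ finrank k V + 1) := by
  by_cases h2 : (2 : k) = 0
  · have : CharP k 2 := CharTwo.of_one_ne_zero_of_two_eq_zero one_ne_zero h2
    obtain ⟨w, hw⟩ : ∃ w : k, w ^ 2 + w + 1 = 0 := by
      have hd : (Polynomial.X ^ 2 + Polynomial.X + 1 : Polynomial k).degree = 2 := by
        compute_degree!
      obtain ⟨w, hw⟩ := IsAlgClosed.exists_root
        (Polynomial.X ^ 2 + Polynomial.X + 1 : Polynomial k) (by rw [hd]; decide)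
      exact ⟨w, by simpa using hw⟩
    refine le_finrank_of_exists_isStandardVector (N := 9) (by omega) ?_
      (hcard.resolve_right fun h => h.1 h2) hρ
    intro α _ _ V _ _ _ ρ hc hn hρ IH
    exact exists_isStandardVector_of_charTwo hw hc fun a b c habc =>
      finrank_threeCycle_eq_one hw hc hn hρ IH habc
  · refine le_finrank_of_exists_isStandardVector (N := 7) (by omega) ?_ (by omega) hρ
    intro α _ _ V _ _ _ ρ hc hn hρ IH
    exact exists_isStandardVector_of_two_ne_zero h2 hc hn hρ IH

end

/-- **Minimal degrees of faithful irreducible representations of alternating groups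
(Wagner, Dickson, James).** Let `φ : Alt_m → GL_n(k)` be a faithful irreducible
representation, and suppose `m ≥ 9`, or `char k ≠ 2` and `m ≥ 7`. Then `n ≥ m − 2`;
moreover, if `char k` is 0 or does not divide `m`, then `n ≥ m − 1`. -/
theorem stmt4 {k : Type*} [Field k] {m n : ℕ}
    (φ : alternatingGroup (Fin m) →* Matrix.GeneralLinearGroup (Fin n) k)
    (hinj : Function.Injective φ) (hirr : IrreducibleRep φ)
    (hcase : 9 ≤ m ∨ (ringChar k ≠ 2 ∧ 7 ≤ m)) :
    m - 2 ≤ n ∧ ((ringChar k = 0 ∨ ¬ ringChar k ∣ m) → m - 1 ≤ n) := by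
  let K := AlgebraicClosure k
  have cast_ne : ∀ l : ℕ, ¬ ringChar k ∣ l → (l : K) ≠ 0 := fun l hl h => by
    rw [← map_natCast (algebraMap k K), map_eq_zero] at h
    exact hl ((ringChar.spec k l).1 h)
  let ρ : Representation K (alternatingGroup (Fin m)) (Fin n → K) :=
    (Matrix.toLinAlgEquiv' : Matrix (Fin n) (Fin n) K ≃ₐ[K] _).toAlgHom.toMonoidHom.comp
      ((Units.coeHom _).comp ((Matrix.GeneralLinearGroup.map (algebraMap k K)).comp φ))
  have hρ : MovesAll ρ := fun a b c d hd h => by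
    have h1 : dswap a b c d = 1 := by
      apply hinj
      rw [map_one]
      refine Units.ext (Matrix.map_injective (algebraMap k K).injective ?_)
      have := Matrix.toLinAlgEquiv'.injective (h.trans (map_one Matrix.toLinAlgEquiv').symm)
      refine Eq.trans this ?_
      simp
    simp only [List.nodup_cons, List.mem_cons, List.not_mem_nil, or_false, not_or,
      List.nodup_nil, and_true, not_false_eq_true] at hd
    have h2 := congrArg (fun g : alternatingGroup (Fin m) => (g : Perm (Fin m)) a) h1
    simp only [coe_dswap hd.1.1 hd.2.2] at h2
    rw [Perm.mul_apply, swap_apply_of_ne_of_ne hd.1.2.1 hd.1.2.2, swap_apply_left] at h2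
    exact hd.1.1 h2.symm
  obtain ⟨h1, h2⟩ := hρ.le_finrank (by
    rw [Fintype.card_fin]
    refine hcase.imp_right (And.imp_left fun h => ?_)
    refine mod_cast cast_ne 2 fun hdvd => h ?_
    exact ((Nat.dvd_prime Nat.prime_two).1 hdvd).resolve_left CharP.ringChar_ne_one)
  rw [Fintype.card_fin, Module.finrank_fin_fun] at h1 h2
  refine ⟨by omega, fun h => ?_⟩
  have := h2 (cast_ne m (h.elim (fun h => ?_) id))
  · omega
  · rw [h, zero_dvd_iff]
    omega
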